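/- arXiv:math/0404075 — 2 statements merged into one kernel-verified Lean document; each statement's English description precedes it below -/
import Mathlib

section
/- Every finitely generated elementary amenable group of exponential growth has uniformly exponential growth, i.e., ω(G) > 1. -/
section GrowthDefs

variable {G : Type*} [Group G]

/-- The ball of radius `n` w.r.t. a finite set `X`: all elements of `G` that are products
of at most `n` letters from `X ∪ X⁻¹`. -/
def wordBall (X : Finset G) (n : ℕ) : Set G :=
  {g | ∃ l : List G, l.length ≤ n ∧ (∀ x ∈ l, x ∈ X ∨ x⁻¹ ∈ X) ∧ l.prod = g}

/-- The growth function `γ_G^X(n) = card {g ∈ G : ‖g‖_X ≤ n}`. -/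
noncomputable def growthFn (X : Finset G) (n : ℕ) : ℕ :=
  Nat.card (wordBall X n)

/-- The exponential growth rate `ω(G,X) = lim_{n→∞} γ_G^X(n)^{1/n}`, which by
submultiplicativity of the growth function equals `inf_{n ≥ 1} γ_G^X(n)^{1/n}`. -/
noncomputable def growthRateX (X : Finset G) : ℝ :=
  ⨅ n : ℕ, (growthFn X (n + 1) : ℝ) ^ ((1 : ℝ) / (n + 1))

/-- The minimal exponential growth rate `ω(G) = inf_X ω(G,X)`, the infimum being taken
over all finite generating sets `X` of `G`. -/
noncomputable def minGrowthRate (G : Type*) [Group G] : ℝ :=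
  sInf {r : ℝ | ∃ X : Finset G, Subgroup.closure (X : Set G) = ⊤ ∧ r = growthRateX X}

/-- `G` has exponential growth: `ω(G,X) > 1` for some (equivalently, every) finite
generating set `X`. -/
def HasExponentialGrowth (G : Type*) [Group G] : Prop :=
  ∃ X : Finset G, Subgroup.closure (X : Set G) = ⊤ ∧ 1 < growthRateX X

end GrowthDefs

universe u

/-- The class `EG` of elementary amenable groups: the smallest class of groups containing
all abelian groups and all finite groups and closed under taking subgroups, taking
quotient groups, group extensions and direct limits (directed unions). -/
inductive ElementaryAmenable : (G : Type u) → Group G → Prop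
  | abelian (G : Type u) [inst : Group G] (h : ∀ a b : G, a * b = b * a) :
      ElementaryAmenable G inst
  | finite (G : Type u) [inst : Group G] (h : Finite G) : ElementaryAmenable G inst
  | subgroup {G H : Type u} [instG : Group G] [instH : Group H] (f : H →* G)
      (hf : Function.Injective f) (hG : ElementaryAmenable G instG) :
      ElementaryAmenable H instH
  | quotient {G H : Type u} [instG : Group G] [instH : Group H] (f : G →* H)
      (hf : Function.Surjective f) (hG : ElementaryAmenable G instG) :
      ElementaryAmenable H instH
  | extension {G : Type u} [instG : Group G] (N : Subgroup G) [hN : N.Normal]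
      (h1 : ElementaryAmenable N inferInstance)
      (h2 : ElementaryAmenable (G ⧸ N) inferInstance) :
      ElementaryAmenable G instG
  | directedUnion {G : Type u} [instG : Group G] {ι : Type u} (K : ι → Subgroup G)
      (hdir : Directed (· ≤ ·) K) (htop : ⨆ i, K i = ⊤)
      (h : ∀ i, ElementaryAmenable (K i) inferInstance) :
      ElementaryAmenable G instG

namespace UniformGrowth

variable {G : Type*} [Group G]

/-- The product of a positive word in `a` and `b`, encoded by a list of Booleans. -/
def wordEval (a b : G) (v : List Bool) : G := (v.map fun e => cond e b a).prod

/-- `a` and `b` freely generate a free semigroup, as tested on words of equal length. -/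
def FreePair (a b : G) : Prop :=
  ∀ v w : List Bool, v.length = w.length → wordEval a b v = wordEval a b w → v = w

@[simp] lemma wordEval_nil (a b : G) : wordEval a b [] = 1 := rfl

@[simp] lemma wordEval_cons (a b : G) (e : Bool) (v : List Bool) :
    wordEval a b (e :: v) = cond e b a * wordEval a b v := by
  simp [wordEval]

lemma map_wordEval {H : Type*} [Group H] (f : G →* H) (a b : G) (v : List Bool) :
    f (wordEval a b v) = wordEval (f a) (f b) v := by
  induction v with
  | nil => simp
  | cons e v ih => cases e <;> simp [ih]

lemma FreePair.of_map {H : Type*} [Group H] (f : G →* H) {a b : G}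
    (h : FreePair (f a) (f b)) : FreePair a b := by
  intro v w hl he
  exact h v w hl (by rw [← map_wordEval, ← map_wordEval, he])

lemma FreePair.map_of_injective {H : Type*} [Group H] (f : G →* H) (hf : Function.Injective f)
    {a b : G} (h : FreePair a b) : FreePair (f a) (f b) := by
  intro v w hl he
  exact h v w hl (hf (by rw [map_wordEval, map_wordEval, he]))

lemma wordEval_inv_reverse (a b : G) (v : List Bool) :
    wordEval a⁻¹ b⁻¹ v.reverse = (wordEval a b v)⁻¹ := by
  rw [wordEval, wordEval, List.prod_inv_reverse, List.map_reverse, List.map_map]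
  congr 2
  refine List.map_congr_left fun e _ => ?_
  cases e <;> rfl

lemma FreePair.of_inv {a b : G} (h : FreePair a⁻¹ b⁻¹) : FreePair a b := by
  intro v w hl he
  have := h v.reverse w.reverse (by simpa using hl)
    (by rw [wordEval_inv_reverse, wordEval_inv_reverse, he])
  simpa using this

/-- The subgroup generated by the conjugates `t ^ k * y * t ^ (-k)`, for `k ∈ I`. -/
def conjSpan (t y : G) (I : Set ℤ) : Subgroup G :=
  Subgroup.closure ((fun k : ℤ => t ^ k * y * t ^ (-k)) '' I)

lemma mem_conjSpan {t y : G} {I : Set ℤ} {k : ℤ} (hk : k ∈ I) :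
    t ^ k * y * t ^ (-k) ∈ conjSpan t y I :=
  Subgroup.subset_closure ⟨k, hk, rfl⟩

lemma conjSpan_mono (t y : G) {I J : Set ℤ} (h : I ⊆ J) : conjSpan t y I ≤ conjSpan t y J :=
  Subgroup.closure_mono (Set.image_mono h)

lemma conjSpan_shift {t y x : G} {I J : Set ℤ} (j : ℤ) (h : ∀ k ∈ I, k + j ∈ J)
    (hx : x ∈ conjSpan t y I) : t ^ j * x * t ^ (-j) ∈ conjSpan t y J := by
  have : (conjSpan t y I) ≤ (conjSpan t y J).comap (MulAut.conj (t ^ j)).toMonoidHom := by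
    rw [conjSpan, Subgroup.closure_le]
    rintro _ ⟨k, hk, rfl⟩
    have h1 := mem_conjSpan (t := t) (y := y) (h k hk)
    change t ^ j * (t ^ k * y * t ^ (-k)) * (t ^ j)⁻¹ ∈ conjSpan t y J
    convert h1 using 1
    group
  have h2 : t ^ j * x * (t ^ j)⁻¹ ∈ conjSpan t y J := this hx
  rwa [zpow_neg]

lemma wordEval_mul_zpow_mem (t y : G) (v : List Bool) :
    wordEval t (t * y) v * t ^ (-(v.length : ℤ)) ∈ conjSpan t y (Set.Icc 1 v.length) := by
  induction v with
  | nil => simp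
  | cons e v ih =>
    have h1 := conjSpan_shift (J := Set.Icc 1 ((e :: v).length : ℤ)) 1
      (fun k hk => by simp only [Set.mem_Icc, List.length_cons] at *; push_cast; omega) ih
    have h2 : t ^ (1 : ℤ) * y * t ^ (-1 : ℤ) ∈ conjSpan t y (Set.Icc 1 ((e :: v).length : ℤ)) :=
      mem_conjSpan (by simp)
    have h3 : t ^ (-(((e :: v).length : ℕ) : ℤ)) = t ^ (-(v.length : ℤ)) * t⁻¹ := by
      rw [List.length_cons, ← zpow_neg_one, ← zpow_add]; congr 1; push_cast; ring
    rw [h3]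
    cases e
    · convert h1 using 1
      simp [mul_assoc]
    · convert mul_mem h2 h1 using 1
      simp [mul_assoc]

lemma exists_mem_conjSpan_pos {t y : G} (h : ¬ FreePair t (t * y)) :
    ∃ n : ℕ, y ∈ conjSpan t y (Set.Icc 1 n) := by
  simp only [FreePair, not_forall] at h
  obtain ⟨v, w, hl, he, hne⟩ := h
  induction v generalizing w with
  | nil => cases w with
    | nil => exact absurd rfl hne
    | cons _ _ => simp at hl
  | cons a v ih => cases w with
    | nil => simp at hl
    | cons b w =>
      simp only [List.length_cons, Nat.add_right_cancel_iff] at hl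
      have hv := wordEval_mul_zpow_mem t y v
      have hw := wordEval_mul_zpow_mem t y w
      rw [← hl] at hw
      simp only [wordEval_cons] at he
      have key : ∀ {v w : List Bool}, t * wordEval t (t * y) v = t * y * wordEval t (t * y) w →
          wordEval t (t * y) v * t ^ (-(v.length : ℤ)) ∈ conjSpan t y (Set.Icc 1 v.length) →
          wordEval t (t * y) w * t ^ (-(v.length : ℤ)) ∈ conjSpan t y (Set.Icc 1 v.length) →
          ∃ n : ℕ, y ∈ conjSpan t y (Set.Icc 1 n) := by
        intro v w he hv hw
        refine ⟨v.length, ?_⟩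
        convert mul_mem hv (inv_mem hw) using 1
        rw [mul_assoc, mul_right_inj] at he
        rw [he]
        group
      by_cases hab : a = b
      · subst hab
        exact ih w hl (mul_left_cancel he) (fun h => hne (by rw [h]))
      · cases a <;> cases b
        · exact absurd rfl hab
        · exact key he hv hw
        · exact key he.symm (by rw [← hl]; exact hw) (by rw [← hl]; exact hv)
        · exact absurd rfl hab

lemma exists_mem_conjSpan_neg {t y : G} (h : ¬ FreePair t (t * y)) :
    ∃ n : ℕ, y ∈ conjSpan t y (Set.Icc (-n) (-1)) := by
  have h1 : ¬ FreePair t⁻¹ (t⁻¹ * (t * y⁻¹ * t⁻¹)) := by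
    intro h2
    apply h
    apply FreePair.of_inv
    convert h2 using 1
    group
  obtain ⟨n, hn⟩ := exists_mem_conjSpan_pos h1
  refine ⟨n, ?_⟩
  have h2 : conjSpan t⁻¹ (t * y⁻¹ * t⁻¹) (Set.Icc 1 n) ≤
      conjSpan t y (Set.Icc (1 - n) 0) := by
    rw [conjSpan, Subgroup.closure_le]
    rintro _ ⟨k, hk, rfl⟩
    have h3 := mem_conjSpan (t := t) (y := y) (I := Set.Icc (1 - (n : ℤ)) 0) (k := 1 - k)
      (by simp only [Set.mem_Icc] at *; omega)
    rw [SetLike.mem_coe]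
    convert inv_mem h3 using 1
    simp only [inv_zpow']
    group
  have h3 := conjSpan_shift (J := Set.Icc (-(n : ℤ)) (-1)) (-1)
      (fun k hk => by simp only [Set.mem_Icc] at *; omega) (inv_mem (h2 hn))
  convert h3 using 1
  group

lemma conjSpan_univ_fg {t y : G} (h : ¬ FreePair t (t * y)) :
    (conjSpan t y Set.univ).FG := by
  obtain ⟨n, hn⟩ := exists_mem_conjSpan_pos h
  obtain ⟨m, hm⟩ := exists_mem_conjSpan_neg h
  set N : ℕ := n + m with hN
  have key : conjSpan t y Set.univ = conjSpan t y (Set.Icc 0 N) := by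
    refine le_antisymm ?_ (conjSpan_mono t y (Set.subset_univ _))
    have up : ∀ k : ℕ, t ^ (k : ℤ) * y * t ^ (-(k : ℤ)) ∈ conjSpan t y (Set.Icc 0 N) := by
      intro k
      induction k using Nat.strong_induction_on with
      | _ k ih =>
        by_cases hk : k ≤ N
        · exact mem_conjSpan (by simp only [Set.mem_Icc]; omega)
        · have h1 := conjSpan_shift (J := Set.Icc (k - N : ℤ) (k - 1)) k
            (fun i hi => by simp only [Set.mem_Icc] at *; omega) hm
          refine (?_ : conjSpan t y (Set.Icc (k - N : ℤ) (k - 1)) ≤ _) h1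
          rw [conjSpan, Subgroup.closure_le]
          rintro _ ⟨i, hi, rfl⟩
          simp only [Set.mem_Icc] at hi
          obtain ⟨i, rfl⟩ := Int.eq_ofNat_of_zero_le (show 0 ≤ i by omega)
          exact ih i (by omega)
    have down : ∀ k : ℕ, t ^ (-(k : ℤ)) * y * t ^ (-(-(k : ℤ))) ∈
        conjSpan t y (Set.Icc 0 N) := by
      intro k
      induction k using Nat.strong_induction_on with
      | _ k ih =>
        have h1 := conjSpan_shift (J := Set.Icc (1 - k : ℤ) (n - k)) (-k)
          (fun i hi => by simp only [Set.mem_Icc] at *; omega) hn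
        refine (?_ : conjSpan t y (Set.Icc (1 - k : ℤ) (n - k)) ≤ _) h1
        rw [conjSpan, Subgroup.closure_le]
        rintro _ ⟨i, hi, rfl⟩
        simp only [Set.mem_Icc] at hi
        rcases le_or_gt 0 i with h0 | h0
        · obtain ⟨i, rfl⟩ := Int.eq_ofNat_of_zero_le h0
          exact up i
        · obtain ⟨j, hj⟩ := Int.eq_ofNat_of_zero_le (show 0 ≤ -i by omega)
          obtain rfl : i = -j := by omega
          exact ih j (by omega)
    rw [conjSpan, Subgroup.closure_le]
    rintro _ ⟨k, -, rfl⟩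
    rcases le_or_gt 0 k with h0 | h0
    · obtain ⟨i, rfl⟩ := Int.eq_ofNat_of_zero_le h0
      exact up i
    · obtain ⟨j, hj⟩ := Int.eq_ofNat_of_zero_le (show 0 ≤ -k by omega)
      obtain rfl : k = -j := by omega
      exact down j
  rw [key]
  exact ⟨((Set.finite_Icc (0 : ℤ) N).image _).toFinset, by rw [Set.Finite.coe_toFinset, conjSpan]⟩

end UniformGrowth

namespace UniformGrowth

open scoped Pointwise commutatorElement

variable {G : Type*} [Group G]

/-- A finite symmetric generating set containing the identity. -/
structure SymmGen (S : Set G) : Prop where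
  finite : S.Finite
  one_mem : 1 ∈ S
  inv_eq : S⁻¹ = S
  closure_eq : Subgroup.closure S = ⊤

/-- `G` has, for each `L`, a finite generating set whose products of length `L` contain no pair
freely generating a free semigroup. -/
def ZeroEnt (G : Type*) [Group G] : Prop :=
  ∀ L : ℕ, ∃ S : Set G, SymmGen S ∧ ∀ a ∈ S ^ L, ∀ b ∈ S ^ L, ¬ FreePair a b

namespace SymmGen

variable {S : Set G}

lemma pow_mono (hS : SymmGen S) {m n : ℕ} (h : m ≤ n) : S ^ m ⊆ S ^ n :=
  Set.pow_subset_pow_right hS.one_mem h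

lemma one_mem_pow (hS : SymmGen S) (n : ℕ) : 1 ∈ S ^ n :=
  Set.one_mem_pow hS.one_mem

lemma inv_mem_pow (hS : SymmGen S) {n : ℕ} {x : G} (hx : x ∈ S ^ n) : x⁻¹ ∈ S ^ n := by
  rw [← Set.mem_inv, ← inv_pow, hS.inv_eq]; exact hx

lemma finite_pow (hS : SymmGen S) (n : ℕ) : (S ^ n).Finite := by
  induction n with
  | zero => simp
  | succ n ih => rw [pow_succ]; exact ih.mul hS.finite

lemma mul_mem_pow {m n : ℕ} {x y : G} (hx : x ∈ S ^ m) (hy : y ∈ S ^ n) :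
    x * y ∈ S ^ (m + n) := by
  rw [pow_add]; exact Set.mul_mem_mul hx hy

lemma pow_mem_pow {m : ℕ} {x : G} (hx : x ∈ S ^ m) (n : ℕ) : x ^ n ∈ S ^ (m * n) := by
  rw [pow_mul]; exact Set.pow_mem_pow hx

lemma exists_mem_pow (hS : SymmGen S) (x : G) : ∃ n, x ∈ S ^ n := by
  have hx : x ∈ Subgroup.closure S := hS.closure_eq ▸ Subgroup.mem_top x
  induction hx using Subgroup.closure_induction with
  | mem x hx => exact ⟨1, by simpa using hx⟩
  | one => exact ⟨0, by simp⟩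
  | mul x y _ _ hx hy =>
    obtain ⟨m, hm⟩ := hx
    obtain ⟨n, hn⟩ := hy
    exact ⟨m + n, mul_mem_pow hm hn⟩
  | inv x _ hx =>
    obtain ⟨m, hm⟩ := hx
    exact ⟨m, hS.inv_mem_pow hm⟩

lemma fg (hS : SymmGen S) : Group.FG G := Group.fg_iff.2 ⟨S, hS.closure_eq, hS.finite⟩

end SymmGen

/-- Conjugates of elements of `Z` by elements of `A`. -/
def conjSet (A Z : Set G) : Set G := Set.image2 (fun g y => g * y * g⁻¹) A Z

lemma conjSet_mono {A B Z : Set G} (h : A ⊆ B) : conjSet A Z ⊆ conjSet B Z :=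
  Set.image2_subset_right h

lemma closure_conjSet_le (A Z : Set G) :
    Subgroup.closure (conjSet A Z) ≤ Subgroup.normalClosure Z := by
  rw [Subgroup.closure_le]
  rintro _ ⟨g, -, y, hy, rfl⟩
  exact Subgroup.normalClosure_normal.conj_mem _ (Subgroup.subset_normalClosure hy) g

lemma exists_normalClosure_eq_closure_conjSet {S Z : Set G} (hS : SymmGen S)
    (hfg : (Subgroup.normalClosure Z).FG) :
    ∃ n, Subgroup.normalClosure Z = Subgroup.closure (conjSet (S ^ n) Z) := by
  have h1 : ∀ x ∈ Subgroup.normalClosure Z,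
      ∃ n, x ∈ Subgroup.closure (conjSet (S ^ n) Z) := by
    intro x hx
    induction hx using Subgroup.closure_induction with
    | mem x hx =>
      obtain ⟨y, hy, hc⟩ := Group.mem_conjugatesOfSet_iff.1 hx
      obtain ⟨g, rfl⟩ := isConj_iff.1 hc
      obtain ⟨n, hn⟩ := hS.exists_mem_pow g
      exact ⟨n, Subgroup.subset_closure ⟨g, hn, y, hy, rfl⟩⟩
    | one => exact ⟨0, one_mem _⟩
    | mul x y _ _ hx hy =>
      obtain ⟨m, hm⟩ := hx
      obtain ⟨n, hn⟩ := hy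
      refine ⟨m + n, mul_mem ?_ ?_⟩
      · exact Subgroup.closure_mono (conjSet_mono (hS.pow_mono (by omega))) hm
      · exact Subgroup.closure_mono (conjSet_mono (hS.pow_mono (by omega))) hn
    | inv x _ hx => exact hx.imp fun n hn => inv_mem hn
  obtain ⟨F, hF⟩ := hfg
  have h2 : ∀ x, ∃ n, x ∈ F → x ∈ Subgroup.closure (conjSet (S ^ n) Z) := by
    intro x
    by_cases hx : x ∈ F
    · obtain ⟨n, hn⟩ := h1 x (hF ▸ Subgroup.subset_closure hx)
      exact ⟨n, fun _ => hn⟩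
    · exact ⟨0, fun h => absurd h hx⟩
  choose f hf using h2
  refine ⟨F.sup f, le_antisymm ?_ (closure_conjSet_le _ _)⟩
  rw [← hF, Subgroup.closure_le]
  exact fun x hx => Subgroup.closure_mono (conjSet_mono (hS.pow_mono (Finset.le_sup hx))) (hf x hx)

lemma fg_map {G' : Type*} [Group G'] {H : Subgroup G} (h : H.FG) (f : G →* G') :
    (H.map f).FG := by
  obtain ⟨F, rfl⟩ := h
  rw [MonoidHom.map_closure]
  exact (Subgroup.fg_iff _).2 ⟨_, rfl, F.finite_toSet.image f⟩

lemma fg_of_isCyclic (H : Subgroup G) [IsCyclic H] : H.FG := by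
  obtain ⟨g, hg⟩ := IsCyclic.exists_generator (α := H)
  rw [← Group.fg_iff_subgroup_fg, Group.fg_iff]
  exact ⟨{g}, by rw [← Subgroup.zpowers_eq_closure, Subgroup.eq_top_iff']; exact hg,
    Set.finite_singleton g⟩

lemma zpowers_inf_fg (t : G) (N : Subgroup G) : (Subgroup.zpowers t ⊓ N).FG := by
  have h := fg_map (fg_of_isCyclic (N.subgroupOf (Subgroup.zpowers t)))
    (Subgroup.zpowers t).subtype
  rwa [Subgroup.subgroupOf_map_subtype, inf_comm] at h

/-- If `t` commutes with the generators modulo `Y`, and `t`, `t * y` never generate a free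
semigroup, then the normal closure of `Y` inherits finite generation from that of `Y ∪ {t}`. -/
lemma normalClosure_fg_of_insert {S Y : Set G} (hS : SymmGen S) (hY : Y.Finite) {t : G}
    (hc : ∀ s ∈ S, ⁅s, t⁆ ∈ Y) (hfg : (Subgroup.normalClosure (insert t Y)).FG)
    (hfree : ∀ y ∈ Y, ¬ FreePair t (t * y)) : (Subgroup.normalClosure Y).FG := by
  obtain ⟨n, hn⟩ := exists_normalClosure_eq_closure_conjSet hS hfg
  set N := Subgroup.normalClosure Y with hN
  set τ : G → G := fun g => g * t * g⁻¹ with hτ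
  set B : Subgroup G := ⨆ p ∈ (S ^ n) ×ˢ Y, conjSpan (τ p.1) (p.1 * p.2 * p.1⁻¹) Set.univ with hB
  have hle : ∀ g ∈ S ^ n, ∀ y ∈ Y, conjSpan (τ g) (g * y * g⁻¹) Set.univ ≤ B := fun g hg y hy =>
    le_iSup₂_of_le (f := fun (p : G × G) (_ : p ∈ (S ^ n) ×ˢ Y) =>
      conjSpan (τ p.1) (p.1 * p.2 * p.1⁻¹) Set.univ) (g, y) ⟨hg, hy⟩ le_rfl
  have hyN : ∀ y ∈ Y, ∀ g, g * y * g⁻¹ ∈ N := fun y hy g =>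
    Subgroup.normalClosure_normal.conj_mem _ (Subgroup.subset_normalClosure hy) g
  have hBfg : B.FG := by
    refine Subgroup.FG.biSup ((hS.finite_pow n).prod hY) _ ?_
    rintro ⟨g, y⟩ ⟨hg, hy⟩
    refine conjSpan_univ_fg fun h => hfree y hy ?_
    refine FreePair.of_map (MulAut.conj g).toMonoidHom ?_
    change FreePair (g * t * g⁻¹) (g * (t * y) * g⁻¹)
    rwa [show g * (t * y) * g⁻¹ = g * t * g⁻¹ * (g * y * g⁻¹) by group]
  have hBN : B ≤ N := by
    refine iSup₂_le ?_
    rintro ⟨g, y⟩ ⟨hg, hy⟩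
    rw [conjSpan, Subgroup.closure_le]
    rintro _ ⟨k, -, rfl⟩
    have := Subgroup.normalClosure_normal.conj_mem _ (hyN y hy g) (τ g ^ k)
    rwa [← zpow_neg] at this
  have hcj : ∀ g ∈ S ^ n, ∀ y ∈ Y, ∀ x ∈ conjSpan (τ g) (g * y * g⁻¹) Set.univ, ∀ k : ℤ,
      τ g ^ k * x * τ g ^ (-k) ∈ B := fun g hg y hy x hx k =>
    hle g hg y hy (conjSpan_shift k (fun _ _ => Set.mem_univ _) hx)
  have hgy : ∀ g ∈ S ^ n, ∀ y ∈ Y,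
      g * y * g⁻¹ ∈ conjSpan (τ g) (g * y * g⁻¹) Set.univ := fun g hg y hy => by
    simpa using mem_conjSpan (t := τ g) (y := g * y * g⁻¹) (Set.mem_univ (0 : ℤ))
  have hτB : ∀ m ≤ n, ∀ g ∈ S ^ m, τ g * t⁻¹ ∈ B ∧ (τ g)⁻¹ * t ∈ B := by
    intro m
    induction m with
    | zero =>
      intro _ g hg
      obtain rfl : g = 1 := by simpa using hg
      simp [hτ]
    | succ m ih =>
      intro hm g hg
      rw [pow_succ] at hg
      obtain ⟨g, hg, s, hs, rfl⟩ := hg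
      have hg' := hS.pow_mono (show m ≤ n by omega) hg
      obtain ⟨h1, h2⟩ := ih (by omega) g hg
      have e : τ (g * s) = g * ⁅s, t⁆ * g⁻¹ * τ g := by
        simp only [hτ, commutatorElement_def]; group
      have h3 := hgy g hg' _ (hc s hs)
      constructor
      · have := mul_mem (hle g hg' _ (hc s hs) h3) h1
        simp only [e]
        rwa [mul_assoc]
      · have := mul_mem (hcj g hg' _ (hc s hs) _ (inv_mem h3) (-1)) h2
        simp only [e]
        convert this using 1
        group
  have hnorm : ∀ x ∈ B, t * x * t⁻¹ ∈ B ∧ t⁻¹ * x * t ∈ B := by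
    have h1 : B ≤ B.comap (MulAut.conj t).toMonoidHom := by
      refine iSup₂_le ?_
      rintro ⟨g, y⟩ ⟨hg, hy⟩ x hx
      have h := (hτB n le_rfl g hg).1
      have := mul_mem (mul_mem (inv_mem h) (hcj g hg y hy x hx 1)) h
      change t * x * t⁻¹ ∈ B
      convert this using 1
      group
    have h2 : B ≤ B.comap (MulAut.conj t⁻¹).toMonoidHom := by
      refine iSup₂_le ?_
      rintro ⟨g, y⟩ ⟨hg, hy⟩ x hx
      have h := (hτB n le_rfl g hg).2
      have := mul_mem (mul_mem (inv_mem h) (hcj g hg y hy x hx (-1))) h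
      change t⁻¹ * x * t⁻¹⁻¹ ∈ B
      convert this using 1
      group
    intro x hx
    refine ⟨h1 hx, ?_⟩
    have : t⁻¹ * x * t⁻¹⁻¹ ∈ B := h2 hx
    rwa [inv_inv] at this
  have hnz : Subgroup.zpowers t ≤ Subgroup.normalizer (B : Set G) := by
    rw [Subgroup.zpowers_le, Subgroup.mem_normalizer_iff]
    intro x
    refine ⟨fun h => (hnorm x h).1, fun h => ?_⟩
    have := (hnorm _ h).2
    convert this using 1
    group
  have hH : Subgroup.normalClosure (insert t Y) ≤ B ⊔ Subgroup.zpowers t := by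
    rw [hn, Subgroup.closure_le]
    rintro _ ⟨g, hg, y, rfl | hy, rfl⟩
    · have := Subgroup.mul_mem_sup (hτB n le_rfl g hg).1 (Subgroup.mem_zpowers y)
      simpa using this
    · exact Subgroup.mem_sup_left (hle g hg y hy (hgy g hg y hy))
  have hNeq : N = B ⊔ (Subgroup.zpowers t ⊓ N) := by
    refine le_antisymm (fun x hx => ?_) (sup_le hBN inf_le_right)
    have h1 := hH (Subgroup.normalClosure_mono (Set.subset_insert t Y) hx)
    rw [← SetLike.mem_coe, Subgroup.coe_mul_of_right_le_normalizer_left _ _ hnz] at h1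
    obtain ⟨b, hb, z, hz, rfl⟩ := h1
    exact Subgroup.mul_mem_sup hb ⟨hz, (Subgroup.mul_mem_cancel_left _ (hBN hb)).1 hx⟩
  rw [hNeq]
  exact hBfg.sup (zpowers_inf_fg t N)

/-- Every subgroup containing `K` is finitely generated. -/
def FGAbove (K : Subgroup G) : Prop := ∀ N, K ≤ N → N.FG

lemma mem_sup_zpowers_of_normal {N : Subgroup G} [N.Normal] {t x : G}
    (hx : x ∈ N ⊔ Subgroup.zpowers t) : ∃ y ∈ N, ∃ k : ℤ, x = y * t ^ k := by
  rw [Subgroup.mem_sup_of_normal_left] at hx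
  obtain ⟨y, hy, z, ⟨k, rfl⟩, rfl⟩ := hx
  exact ⟨y, hy, k, rfl⟩

lemma normalClosure_insert_eq {S Y : Set G} (hS : SymmGen S) {t : G}
    (hc : ∀ s ∈ S, ⁅s, t⁆ ∈ Y) :
    Subgroup.normalClosure (insert t Y) = Subgroup.normalClosure Y ⊔ Subgroup.zpowers t := by
  set N := Subgroup.normalClosure Y
  refine le_antisymm ?_ (sup_le (Subgroup.normalClosure_mono (Set.subset_insert t Y))
    (Subgroup.zpowers_le.2 (Subgroup.subset_normalClosure (Set.mem_insert t Y))))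
  have : (N ⊔ Subgroup.zpowers t).Normal := by
    have hcen : ∀ g : G, ⁅g, t⁆ ∈ N := by
      intro g
      have hg : g ∈ Subgroup.closure S := hS.closure_eq ▸ Subgroup.mem_top g
      induction hg using Subgroup.closure_induction with
      | mem s hs => exact Subgroup.subset_normalClosure (hc s hs)
      | one => simp
      | mul a b _ _ ha hb =>
        have h := mul_mem (Subgroup.normalClosure_normal.conj_mem _ hb a) ha
        convert h using 1
        simp only [commutatorElement_def]; group
      | inv a _ ha =>
        have h := Subgroup.normalClosure_normal.conj_mem _ (inv_mem ha) a⁻¹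
        convert h using 1
        simp only [commutatorElement_def]; group
    refine ⟨fun x hx g => ?_⟩
    obtain ⟨y, hy, k, rfl⟩ := mem_sup_zpowers_of_normal hx
    have e : g * (y * t ^ k) * g⁻¹ = (g * y * g⁻¹) * (⁅g, t⁆ * t) ^ k := by
      have : ⁅g, t⁆ * t = g * t * g⁻¹ := by simp [commutatorElement_def]
      rw [this, conj_zpow]; group
    rw [e]
    exact mul_mem (Subgroup.mem_sup_left (Subgroup.normalClosure_normal.conj_mem _ hy g))
      (zpow_mem (Subgroup.mul_mem_sup (hcen g) (Subgroup.mem_zpowers t)) k)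
  refine Subgroup.normalClosure_le_normal ?_
  rintro x (rfl | hx)
  · exact Subgroup.mem_sup_right (Subgroup.mem_zpowers _)
  · exact Subgroup.mem_sup_left (Subgroup.subset_normalClosure hx)

lemma FGAbove.of_insert {S Y : Set G} (hS : SymmGen S) (hY : Y.Finite) {t : G}
    (hc : ∀ s ∈ S, ⁅s, t⁆ ∈ Y) (hfg : FGAbove (Subgroup.normalClosure (insert t Y)))
    (hfree : ∀ y ∈ Y, ¬ FreePair t (t * y)) : FGAbove (Subgroup.normalClosure Y) := by
  intro N hN
  set K := Subgroup.normalClosure Y with hK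
  set H := Subgroup.normalClosure (insert t Y) with hH
  have hHeq : H = K ⊔ Subgroup.zpowers t := normalClosure_insert_eq hS hc
  have hKfg : K.FG := normalClosure_fg_of_insert hS hY hc (hfg H le_rfl) hfree
  have h1 : (N ⊓ H) = K ⊔ (Subgroup.zpowers t ⊓ N) := by
    refine le_antisymm ?_ (sup_le (le_inf hN (hHeq ▸ le_sup_left)) (le_inf inf_le_right
      (inf_le_left.trans (hHeq ▸ le_sup_right))))
    rintro x ⟨hx, hxH⟩
    rw [SetLike.mem_coe, hHeq] at hxH
    obtain ⟨y, hy, k, rfl⟩ := mem_sup_zpowers_of_normal hxH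
    exact Subgroup.mul_mem_sup hy ⟨⟨k, rfl⟩, (Subgroup.mul_mem_cancel_left _ (hN hy)).1 hx⟩
  have h2 : (N ⊓ H).FG := h1 ▸ hKfg.sup (zpowers_inf_fg t N)
  obtain ⟨F, hF⟩ := hfg (N ⊔ H) le_sup_right
  have h3 : ∀ x, ∃ n, x ∈ F → n ∈ N ∧ n⁻¹ * x ∈ H := by
    intro x
    by_cases hx : x ∈ F
    · have : x ∈ N ⊔ H := hF ▸ Subgroup.subset_closure hx
      rw [Subgroup.mem_sup_of_normal_right] at this
      obtain ⟨n, hn, h, hh, rfl⟩ := this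
      exact ⟨n, fun _ => ⟨hn, by simpa using hh⟩⟩
    · exact ⟨1, fun h => absurd h hx⟩
  choose f hf using h3
  set P : Subgroup G := Subgroup.closure (f '' F) with hP
  have hPfg : P.FG := (Subgroup.fg_iff P).2 ⟨_, rfl, F.finite_toSet.image f⟩
  have hPN : P ≤ N := by
    rw [hP, Subgroup.closure_le]
    rintro _ ⟨x, hx, rfl⟩
    exact (hf x hx).1
  have h4 : N ⊔ H ≤ P ⊔ H := by
    rw [← hF, Subgroup.closure_le]
    intro x hx
    have := Subgroup.mul_mem_sup (Subgroup.subset_closure (Set.mem_image_of_mem f hx) : f x ∈ P)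
      (hf x hx).2
    simpa using this
  have h5 : N = P ⊔ (N ⊓ H) := by
    refine le_antisymm (fun x hx => ?_) (sup_le hPN inf_le_left)
    have := h4 (Subgroup.mem_sup_left hx)
    rw [Subgroup.mem_sup_of_normal_right] at this
    obtain ⟨p, hp, h, hh, rfl⟩ := this
    exact Subgroup.mul_mem_sup hp ⟨(Subgroup.mul_mem_cancel_left _ (hPN hp)).1 hx, hh⟩
  rw [h5]
  exact hPfg.sup h2

lemma FGAbove.of_union {S Y T : Set G} (hS : SymmGen S) (hY : Y.Finite) (hT : T.Finite)
    (hc : ∀ s ∈ S, ∀ t ∈ T, ⁅s, t⁆ ∈ Y)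
    (hfg : FGAbove (Subgroup.normalClosure (T ∪ Y)))
    (hfree : ∀ t ∈ T, ∀ y ∈ T ∪ Y, ¬ FreePair t (t * y)) :
    FGAbove (Subgroup.normalClosure Y) := by
  induction T, hT using Set.Finite.induction_on with
  | empty => simpa using hfg
  | @insert t T _ hT ih =>
    refine ih (fun s hs t ht => hc s hs t (Or.inr ht)) ?_
      (fun t ht y hy => hfree t (Or.inr ht) y ?_)
    · refine FGAbove.of_insert hS (hT.union hY) (t := t)
        (fun s hs => Or.inr (hc s hs t (Or.inl rfl))) (by rwa [← Set.insert_union]) ?_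
      exact fun y hy => hfree t (Or.inl rfl) y (Or.imp Or.inr id hy)
    · exact Or.imp Or.inr id hy

end UniformGrowth

namespace UniformGrowth

open scoped Pointwise commutatorElement

variable {G : Type*} [Group G]

/-- The lower central series of a subgroup, as subgroups of the ambient group. -/
abbrev lcs (H : Subgroup G) (n : ℕ) : Subgroup G := H.lowerCentralSeries n

lemma lcs_succ (H : Subgroup G) (n : ℕ) : lcs H (n + 1) = ⁅lcs H n, H⁆ := rfl

lemma lcs_mono {H K : Subgroup G} (h : H ≤ K) (n : ℕ) : lcs H n ≤ lcs K n := by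
  induction n with
  | zero => exact h
  | succ n ih => exact Subgroup.commutator_mono ih h

lemma map_lcs {G' : Type*} [Group G'] (f : G →* G') (H : Subgroup G) (n : ℕ) :
    (lcs H n).map f = lcs (H.map f) n := by
  induction n with
  | zero => rfl
  | succ n ih => rw [lcs_succ, Subgroup.map_commutator, ih, lcs_succ]

lemma lcs_top_map_subtype (H : Subgroup G) (n : ℕ) :
    (lcs (⊤ : Subgroup H) n).map H.subtype = lcs H n := by
  rw [map_lcs, ← MonoidHom.range_eq_map, Subgroup.range_subtype]

lemma lcs_normal (H : Subgroup G) [H.Normal] (n : ℕ) : (lcs H n).Normal := by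
  induction n with
  | zero => assumption
  | succ n ih => rw [lcs_succ]; exact Subgroup.commutator_normal _ _

lemma lcs_antitone (H : Subgroup G) : Antitone (lcs H) := by
  have h1 : Antitone (lcs (⊤ : Subgroup H)) := by
    refine antitone_nat_of_succ_le fun n => ?_
    have := lcs_normal (⊤ : Subgroup H) n
    exact Subgroup.commutator_le_left (lcs (⊤ : Subgroup H) n) ⊤
  intro m n h
  rw [← lcs_top_map_subtype H n, ← lcs_top_map_subtype H m]
  exact Subgroup.map_mono (h1 h)

/-- Iterated commutators of the elements of `S`. -/
def commIter (S : Set G) : ℕ → Set G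
  | 0 => S
  | i + 1 => Set.image2 (fun s t => ⁅s, t⁆) S (commIter S i)

/-- A bound for the length of the elements of `commIter S i` over `S`. -/
def commLen : ℕ → ℕ
  | 0 => 1
  | i + 1 => 2 * commLen i + 2

lemma commLen_mono : Monotone commLen := monotone_nat_of_le_succ fun n => by
  rw [commLen]; omega

lemma commIter_subset {S : Set G} (hS : SymmGen S) (i : ℕ) : commIter S i ⊆ S ^ commLen i := by
  induction i with
  | zero => simp [commIter, commLen]
  | succ i ih =>
    rintro _ ⟨s, hs, t, ht, rfl⟩
    have h1 : s ∈ S ^ 1 := by simpa using hs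
    have h2 := ih ht
    have h3 := SymmGen.mul_mem_pow (SymmGen.mul_mem_pow (SymmGen.mul_mem_pow h1 h2)
      (hS.inv_mem_pow h1)) (hS.inv_mem_pow h2)
    rwa [show 1 + commLen i + 1 + commLen i = commLen (i + 1) by rw [commLen]; ring] at h3

lemma commIter_finite {S : Set G} (hS : SymmGen S) (i : ℕ) : (commIter S i).Finite := by
  induction i with
  | zero => exact hS.finite
  | succ i ih => exact hS.finite.image2 _ ih

lemma commutator_normalClosure_le {S Z : Set G} (hS : Subgroup.closure S = ⊤) {M : Subgroup G}
    [M.Normal] (h : ∀ s ∈ S, ∀ t ∈ Z, ⁅s, t⁆ ∈ M) : ⁅Subgroup.normalClosure Z, ⊤⁆ ≤ M := by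
  have h1 : Subgroup.normalClosure Z ≤
      (Subgroup.center (G ⧸ M)).comap (QuotientGroup.mk' M) := by
    refine Subgroup.normalClosure_le_normal fun t ht => ?_
    have h2 : Subgroup.closure S ≤
        (Subgroup.centralizer {QuotientGroup.mk' M t}).comap (QuotientGroup.mk' M) := by
      rw [Subgroup.closure_le]
      intro s hs
      have h3 : ⁅(s : G ⧸ M), (t : G ⧸ M)⁆ = 1 :=
        (QuotientGroup.eq_one_iff _).2 (h s hs t ht)
      rw [commutatorElement_eq_one_iff_mul_comm] at h3
      exact Subgroup.mem_centralizer_singleton_iff.2 h3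
    rw [SetLike.mem_coe, Subgroup.mem_comap, Subgroup.mem_center_iff]
    intro g
    induction g using QuotientGroup.induction_on with
    | H g =>
      have h4 : g ∈ Subgroup.closure S := hS ▸ Subgroup.mem_top g
      exact Subgroup.mem_centralizer_singleton_iff.1 (h2 h4)
  rw [Subgroup.commutator_le]
  intro x hx g _
  have h5 := Subgroup.mem_center_iff.1 (h1 hx) (g : G ⧸ M)
  rw [← QuotientGroup.eq_one_iff]
  exact commutatorElement_eq_one_iff_mul_comm.2 h5.symm

lemma normalClosure_commIter {S : Set G} (hS : SymmGen S) (i : ℕ) :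
    Subgroup.normalClosure (commIter S i) = lcs ⊤ i := by
  induction i with
  | zero =>
    exact top_le_iff.1 (hS.closure_eq.symm.le.trans Subgroup.closure_le_normalClosure)
  | succ i ih =>
    refine le_antisymm ?_ ?_
    · have := lcs_normal (⊤ : Subgroup G) (i + 1)
      refine Subgroup.normalClosure_le_normal ?_
      rintro _ ⟨s, hs, t, ht, rfl⟩
      rw [SetLike.mem_coe, lcs_succ, Subgroup.commutator_comm, ← ih]
      exact Subgroup.commutator_mem_commutator (Subgroup.mem_top s)
        (Subgroup.subset_normalClosure ht)
    · rw [lcs_succ, ← ih]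
      exact commutator_normalClosure_le hS.closure_eq fun s hs t ht =>
        Subgroup.subset_normalClosure ⟨s, hs, t, ht, rfl⟩

lemma ZeroEnt.fgAbove_lcs_top (h : ZeroEnt G) (c : ℕ) : FGAbove (lcs (⊤ : Subgroup G) c) := by
  obtain ⟨S, hS, hfree⟩ := h (2 * commLen c)
  suffices ∀ i ≤ c, FGAbove (lcs (⊤ : Subgroup G) i) from this c le_rfl
  intro i
  induction i with
  | zero =>
    intro _ N hN
    obtain rfl : N = ⊤ := top_le_iff.1 hN
    exact Group.fg_def.1 hS.fg
  | succ i ih =>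
    intro hi
    rw [← normalClosure_commIter hS]
    refine FGAbove.of_union hS (commIter_finite hS _) (commIter_finite hS i)
      (fun s hs t ht => ⟨s, hs, t, ht, rfl⟩) ?_ ?_
    · rw [Subgroup.normalClosure_union, normalClosure_commIter hS, normalClosure_commIter hS,
        sup_of_le_left (lcs_antitone _ (Nat.le_succ i))]
      exact ih (by omega)
    · intro t ht y hy
      have h1 : t ∈ S ^ commLen c :=
        hS.pow_mono (commLen_mono (by omega)) (commIter_subset hS _ ht)
      have h2 : y ∈ S ^ commLen c := by
        rcases hy with hy | hy
        · exact hS.pow_mono (commLen_mono (by omega)) (commIter_subset hS _ hy)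
        · exact hS.pow_mono (commLen_mono (by omega)) (commIter_subset hS _ hy)
      refine hfree _ (hS.pow_mono (by omega) h1) _ ?_
      rw [two_mul]
      exact SymmGen.mul_mem_pow h1 h2

lemma fg_of_finiteRelIndex {K N : Subgroup G} (hKN : K ≤ N) [K.IsFiniteRelIndex N]
    (hK : K.FG) : N.FG := by
  have : (K.subgroupOf N).FiniteIndex := ⟨Subgroup.IsFiniteRelIndex.relIndex_ne_zero⟩
  set R : Set G := Set.range fun q : N ⧸ K.subgroupOf N => (q.out : G) with hR
  have h : N = K ⊔ Subgroup.closure R := by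
    refine le_antisymm (fun x hx => ?_) (sup_le hKN ?_)
    · have h1 : (((⟨x, hx⟩ : N) : N ⧸ K.subgroupOf N).out)⁻¹ * ⟨x, hx⟩ ∈ K.subgroupOf N :=
        QuotientGroup.eq.1 (Quotient.out_eq' _)
      have h2 := mul_mem (Subgroup.mem_sup_right (T := Subgroup.closure R) (S := K)
        (Subgroup.subset_closure ⟨((⟨x, hx⟩ : N) : N ⧸ K.subgroupOf N), rfl⟩))
        (Subgroup.mem_sup_left (Subgroup.mem_subgroupOf.1 h1))
      simpa using h2
    · rw [Subgroup.closure_le]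
      rintro _ ⟨q, rfl⟩
      exact q.out.2
  rw [h]
  exact hK.sup ((Subgroup.fg_iff _).2 ⟨R, rfl, Set.finite_range _⟩)

end UniformGrowth

namespace UniformGrowth

open scoped Pointwise commutatorElement

variable {G : Type*} [Group G]

lemma ZeroEnt.of_surjective {G' : Type*} [Group G'] (h : ZeroEnt G) (f : G →* G')
    (hf : Function.Surjective f) : ZeroEnt G' := by
  intro L
  obtain ⟨S, hS, hfree⟩ := h L
  refine ⟨f '' S, ⟨hS.finite.image f, ⟨1, hS.one_mem, map_one f⟩, ?_, ?_⟩, ?_⟩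
  · rw [← Set.image_inv, hS.inv_eq]
  · rw [← MonoidHom.map_closure, hS.closure_eq, ← MonoidHom.range_eq_map,
      MonoidHom.range_eq_top.2 hf]
  · rw [← Set.image_pow]
    rintro _ ⟨a, ha, rfl⟩ _ ⟨b, hb, rfl⟩ hab
    exact hfree a ha b hb (hab.of_map f)

lemma SymmGen.exists_mem_pow_index {S : Set G} (hS : SymmGen S) (H : Subgroup G)
    [H.FiniteIndex] (x : G) : ∃ r ∈ S ^ H.index, r⁻¹ * x ∈ H := by
  set A : ℕ → Set (G ⧸ H) := fun n => (fun g : G => (g : G ⧸ H)) '' (S ^ n) with hA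
  have hmono : ∀ n, A n ⊆ A (n + 1) := fun n => Set.image_mono (hS.pow_mono (Nat.le_succ n))
  have key : ∀ n, A n = Set.univ ∨ n + 1 ≤ (A n).ncard := by
    intro n
    induction n with
    | zero =>
      right
      exact (Set.ncard_pos (Set.toFinite _)).2 ⟨_, 1, hS.one_mem_pow 0, rfl⟩
    | succ n ih =>
      rcases ih with ih | ih
      · exact Or.inl (Set.eq_univ_of_univ_subset (ih ▸ hmono n))
      · by_cases he : A n = A (n + 1)
        · left
          rw [← he, Set.eq_univ_iff_forall]
          have h1 : ∀ m, ∀ g ∈ S ^ m, (g : G ⧸ H) ∈ A n := by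
            intro m
            induction m with
            | zero =>
              intro g hg
              obtain rfl : g = 1 := by simpa using hg
              exact ⟨1, hS.one_mem_pow n, rfl⟩
            | succ m ihm =>
              intro g hg
              rw [pow_succ'] at hg
              obtain ⟨s, hs, g, hg, rfl⟩ := hg
              obtain ⟨g', hg', e⟩ := ihm g hg
              rw [he]
              refine ⟨s * g', ?_, ?_⟩
              · rw [pow_succ']; exact Set.mul_mem_mul hs hg'
              · rw [QuotientGroup.eq] at e ⊢
                convert e using 1
                group
          intro q
          induction q using QuotientGroup.induction_on with
          | H g =>
            obtain ⟨m, hm⟩ := hS.exists_mem_pow g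
            exact h1 m g hm
        · right
          have := Set.ncard_lt_ncard (lt_of_le_of_ne (hmono n) he) (Set.toFinite _)
          omega
  have huniv : A H.index = Set.univ := by
    rcases key H.index with h | h
    · exact h
    · have h1 := Set.ncard_le_card (A H.index)
      rw [← Subgroup.index_eq_card] at h1
      omega
  have hx : (x : G ⧸ H) ∈ A H.index := huniv ▸ Set.mem_univ _
  obtain ⟨r, hr, e⟩ := hx
  exact ⟨r, hr, QuotientGroup.eq.1 e⟩

/-- Schreier generators of a subgroup of finite index. -/
def schreierSet (S : Set G) (H : Subgroup G) : Set H := Subtype.val ⁻¹' (S ^ (2 * H.index + 1))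

lemma SymmGen.schreierSet {S : Set G} (hS : SymmGen S) (H : Subgroup G) [H.FiniteIndex] :
    SymmGen (schreierSet S H) := by
  refine ⟨(hS.finite_pow _).preimage Subtype.val_injective.injOn, hS.one_mem_pow _, ?_, ?_⟩
  · ext x
    refine ⟨fun h => ?_, fun h => ?_⟩
    · have := hS.inv_mem_pow (show ((x⁻¹ : H) : G) ∈ _ from h)
      simpa [UniformGrowth.schreierSet] using this
    · exact hS.inv_mem_pow h
  · set Y := UniformGrowth.schreierSet S H with hY
    set C := (Subgroup.closure Y).map H.subtype with hC
    have hYC : ∀ y ∈ H, y ∈ S ^ (2 * H.index + 1) → y ∈ C := fun y hy hy' =>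
      ⟨⟨y, hy⟩, Subgroup.subset_closure hy', rfl⟩
    have claim : ∀ m, ∀ g ∈ S ^ m, ∃ r ∈ S ^ H.index, r⁻¹ * g ∈ C := by
      intro m
      induction m with
      | zero =>
        intro g hg
        obtain rfl : g = 1 := by simpa using hg
        exact ⟨1, hS.one_mem_pow _, by simp⟩
      | succ m ih =>
        intro g hg
        rw [pow_succ'] at hg
        obtain ⟨s, hs, g, hg, rfl⟩ := hg
        obtain ⟨r, hr, hrg⟩ := ih g hg
        obtain ⟨r', hr', h'⟩ := hS.exists_mem_pow_index H (s * r)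
        refine ⟨r', hr', ?_⟩
        have h1 : r'⁻¹ * (s * r) ∈ S ^ (2 * H.index + 1) := by
          have hs' : s ∈ S ^ 1 := by simpa using hs
          have := mul_mem_pow (hS.inv_mem_pow hr') (mul_mem_pow hs' hr)
          rwa [show H.index + (1 + H.index) = 2 * H.index + 1 by ring] at this
        convert mul_mem (hYC _ h' h1) hrg using 1
        group
    rw [Subgroup.eq_top_iff']
    rintro ⟨h, hh⟩
    obtain ⟨m, hm⟩ := hS.exists_mem_pow h
    obtain ⟨r, hr, hrh⟩ := claim m h hm
    have hCH : C ≤ H := by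
      rw [hC]; exact Subgroup.map_subtype_le _
    have hrH : r ∈ H := by
      have := hCH hrh
      rw [Subgroup.mul_mem_cancel_right _ hh] at this
      simpa using this
    have h2 : h ∈ C := by
      have := mul_mem (hYC r hrH (hS.pow_mono (by omega) hr)) hrh
      simpa using this
    obtain ⟨x, hx, hxe⟩ := h2
    have : x = ⟨h, hh⟩ := Subtype.ext hxe
    exact this ▸ hx

lemma ZeroEnt.of_finiteIndex (h : ZeroEnt G) (H : Subgroup G) [H.FiniteIndex] : ZeroEnt H := by
  intro L
  obtain ⟨S, hS, hfree⟩ := h ((2 * H.index + 1) * L)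
  refine ⟨schreierSet S H, hS.schreierSet H, fun a ha b hb hab => ?_⟩
  have h1 : ∀ x ∈ schreierSet S H ^ L, (x : G) ∈ S ^ ((2 * H.index + 1) * L) := by
    intro x hx
    have h2 : H.subtype x ∈ H.subtype '' (schreierSet S H ^ L) := ⟨x, hx, rfl⟩
    rw [Set.image_pow] at h2
    rw [pow_mul]
    refine Set.pow_subset_pow_left ?_ h2
    rintro _ ⟨y, hy, rfl⟩
    exact hy
  exact hfree _ (h1 a ha) _ (h1 b hb) (hab.map_of_injective H.subtype H.subtype_injective)

/-- Subgroups containing a term of the lower central series of a finite index subgroup are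
finitely generated. -/
lemma ZeroEnt.fg_of_lcs_le (h : ZeroEnt G) {H : Subgroup G} [H.FiniteIndex] {c : ℕ}
    {N : Subgroup G} (hN : lcs H c ≤ N) : N.FG := by
  have h1 : (N.subgroupOf H).FG := by
    refine (h.of_finiteIndex H).fgAbove_lcs_top c _ ?_
    exact (Subgroup.map_le_iff_le_comap).1 ((lcs_top_map_subtype H c).le.trans hN)
  have h2 := fg_map h1 H.subtype
  rw [Subgroup.subgroupOf_map_subtype] at h2
  have : (N ⊓ H).IsFiniteRelIndex N := ⟨by
    rw [inf_comm, Subgroup.inf_relIndex_right]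
    exact fun h0 => Subgroup.FiniteIndex.index_ne_zero (H := H)
      (by rw [← Subgroup.relIndex_top_right]
          exact Subgroup.relIndex_eq_zero_of_le_right le_top h0)⟩
  exact fg_of_finiteRelIndex inf_le_left h2

lemma wordBall_eq_pow (X : Finset G) (n : ℕ) :
    wordBall X n = (insert 1 ((X : Set G) ∪ (X : Set G)⁻¹)) ^ n := by
  set S : Set G := insert 1 ((X : Set G) ∪ (X : Set G)⁻¹) with hS
  ext g
  constructor
  · rintro ⟨l, hl, hX, rfl⟩
    refine Set.pow_subset_pow_right (Set.mem_insert _ _) hl ?_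
    clear hl
    induction l with
    | nil => simp
    | cons a l ih =>
      rw [List.prod_cons, List.length_cons, pow_succ']
      refine Set.mul_mem_mul ?_ (ih fun x hx => hX x (List.mem_cons_of_mem _ hx))
      exact Or.inr (hX a List.mem_cons_self)
  · induction n generalizing g with
    | zero =>
      intro hg
      obtain rfl : g = 1 := by simpa using hg
      exact ⟨[], by simp⟩
    | succ n ih =>
      intro hg
      rw [pow_succ'] at hg
      obtain ⟨s, hs, g, hg, rfl⟩ := hg
      obtain ⟨l, hl, hX, rfl⟩ := ih g hg
      rcases hs with rfl | hs
      · exact ⟨l, by omega, hX, by simp⟩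
      · refine ⟨s :: l, by simpa using hl, ?_, by simp⟩
        intro x hx
        rcases List.mem_cons.1 hx with rfl | hx
        · exact hs
        · exact hX x hx

lemma symmGen_of_closure_eq_top {X : Finset G} (hX : Subgroup.closure (X : Set G) = ⊤) :
    SymmGen (insert 1 ((X : Set G) ∪ (X : Set G)⁻¹)) := by
  refine ⟨(X.finite_toSet.union X.finite_toSet.inv).insert 1, Set.mem_insert _ _, ?_, ?_⟩
  · rw [Set.inv_insert, Set.union_inv, inv_inv, inv_one, Set.union_comm]
  · rw [← top_le_iff, ← hX]
    exact Subgroup.closure_mono fun x hx => Or.inr (Or.inl hx)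

lemma wordEval_mem_pow {S : Set G} {L : ℕ} {a b : G} (ha : a ∈ S ^ L) (hb : b ∈ S ^ L)
    (v : List Bool) : wordEval a b v ∈ S ^ (L * v.length) := by
  induction v with
  | nil => simp
  | cons e v ih =>
    rw [wordEval_cons, List.length_cons, Nat.mul_succ, add_comm]
    exact SymmGen.mul_mem_pow (by cases e <;> assumption) ih

lemma FreePair.two_pow_le {S : Set G} (hS : SymmGen S) {L : ℕ} {a b : G} (ha : a ∈ S ^ L)
    (hb : b ∈ S ^ L) (h : FreePair a b) (N : ℕ) : 2 ^ N ≤ (S ^ N).ncard ^ L := by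
  have h1 : 2 ^ N ≤ (S ^ (L * N)).ncard := by
    have := (hS.finite_pow (L * N)).to_subtype
    have hinj : Function.Injective (fun v : Fin N → Bool =>
        (⟨wordEval a b (List.ofFn v), by
          have := wordEval_mem_pow ha hb (List.ofFn v)
          rwa [List.length_ofFn] at this⟩ : (S ^ (L * N) : Set G))) := by
      intro v w hvw
      exact List.ofFn_injective (h _ _ (by simp) (Subtype.ext_iff.1 hvw))
    simpa using Nat.card_le_card_of_injective _ hinj
  refine h1.trans ?_
  rw [mul_comm, pow_mul]
  have := (hS.finite_pow N)
  obtain ⟨F, hF⟩ := this.exists_finset_coe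
  rw [← hF]
  classical
  rw [← Finset.coe_pow, Set.ncard_coe_finset, Set.ncard_coe_finset]
  exact Finset.card_pow_le

lemma zeroEnt_of_minGrowthRate_le_one (hfg : Group.FG G) (h : minGrowthRate G ≤ 1) :
    ZeroEnt G := by
  intro L
  have h1 : (1 : ℝ) < 2 ^ ((1 : ℝ) / (L + 1)) := Real.one_lt_rpow (by norm_num) (by positivity)
  obtain ⟨X₀, hX₀⟩ := Group.fg_def.1 hfg
  obtain ⟨_, ⟨X, hX, rfl⟩, hlt⟩ := exists_lt_of_csInf_lt (⟨_, X₀, hX₀, rfl⟩ :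
    {r : ℝ | ∃ X : Finset G, Subgroup.closure (X : Set G) = ⊤ ∧ r = growthRateX X}.Nonempty)
    (h.trans_lt h1)
  obtain ⟨n, hn⟩ := exists_lt_of_ciInf_lt hlt
  have hS := symmGen_of_closure_eq_top hX
  refine ⟨_, hS, fun a ha b hb hab => ?_⟩
  have h2 := hab.two_pow_le hS (hS.pow_mono (Nat.le_succ L) ha) (hS.pow_mono (Nat.le_succ L) hb)
    (n + 1)
  rw [← wordBall_eq_pow] at h2
  have h3 : ((growthFn X (n + 1) : ℝ) ^ ((1 : ℝ) / (n + 1))) ^ ((n + 1) * (L + 1)) <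
      ((2 : ℝ) ^ ((1 : ℝ) / (L + 1))) ^ ((n + 1) * (L + 1)) :=
    pow_lt_pow_left₀ hn (by positivity) (by positivity)
  rw [pow_mul, mul_comm (n + 1), pow_mul] at h3
  have e : ∀ (x : ℝ) (hx : 0 ≤ x) (k : ℕ), (x ^ ((1 : ℝ) / (k + 1))) ^ (k + 1) = x := by
    intro x hx k
    rw [one_div]
    exact_mod_cast Real.rpow_inv_natCast_pow hx (Nat.succ_ne_zero k)
  rw [e _ (by positivity), e _ (by positivity)] at h3
  have h4 : growthFn X (n + 1) ^ (L + 1) < 2 ^ (n + 1) := by exact_mod_cast h3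
  exact absurd h2 (not_le.2 h4)

end UniformGrowth

namespace UniformGrowth

open scoped Pointwise commutatorElement

variable {G : Type*} [Group G]

/-- Some term of the lower central series of a normal finite index subgroup lies in `N`. If `N`
is normal, this says that `G ⧸ N` is virtually nilpotent. -/
def VNmod (N : Subgroup G) : Prop :=
  ∃ H : Subgroup G, H.Normal ∧ H.FiniteIndex ∧ ∃ c, lcs H c ≤ N

/-- `G` is virtually nilpotent. -/
def VN (G : Type*) [Group G] : Prop := VNmod (⊥ : Subgroup G)

lemma VNmod.of_finiteIndex {N : Subgroup G} (H : Subgroup G) [H.FiniteIndex] {c : ℕ}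
    (h : lcs H c ≤ N) : VNmod N :=
  ⟨H.normalCore, inferInstance, inferInstance, c, (lcs_mono H.normalCore_le c).trans h⟩

lemma VNmod.mono {N N' : Subgroup G} (h : VNmod N) (hN : N ≤ N') : VNmod N' := by
  obtain ⟨H, h1, h2, c, h3⟩ := h
  exact ⟨H, h1, h2, c, h3.trans hN⟩

lemma VN.of_subgroup (H : Subgroup G) [H.FiniteIndex] (h : VN H) : VN G := by
  obtain ⟨K, -, hK, c, hc⟩ := h
  have : (K.map H.subtype).FiniteIndex := ⟨by
    rw [Subgroup.index_map_subtype]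
    exact mul_ne_zero hK.index_ne_zero Subgroup.FiniteIndex.index_ne_zero⟩
  refine VNmod.of_finiteIndex (K.map H.subtype) (c := c) ?_
  rw [← map_lcs, le_bot_iff, le_bot_iff.1 hc, Subgroup.map_bot]

lemma VNmod.of_quotient {N : Subgroup G} [N.Normal] (h : VN (G ⧸ N)) : VNmod N := by
  obtain ⟨K, -, hK, c, hc⟩ := h
  have : (K.comap (QuotientGroup.mk' N)).FiniteIndex := ⟨by
    rw [Subgroup.index_comap_of_surjective _ (QuotientGroup.mk'_surjective N)]
    exact hK.index_ne_zero⟩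
  refine VNmod.of_finiteIndex (K.comap (QuotientGroup.mk' N)) (c := c) ?_
  have h1 : (lcs (K.comap (QuotientGroup.mk' N)) c).map (QuotientGroup.mk' N) ≤ ⊥ := by
    rw [map_lcs]
    exact (lcs_mono (Subgroup.map_comap_le _ _) c).trans hc
  rwa [Subgroup.map_le_iff_le_comap, MonoidHom.comap_bot, QuotientGroup.ker_mk'] at h1

lemma VN.of_finite_normal (A : Subgroup G) [A.Normal] [Finite A] (h : VNmod A) : VN G := by
  obtain ⟨H, -, hH, c, hc⟩ := h
  have : Finite (MulAut A) := Finite.of_injective (fun f : MulAut A => (f : A → A))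
    DFunLike.coe_injective
  set C := (MulAut.conjNormal : G →* MulAut A).ker with hC
  have : C.FiniteIndex := inferInstance
  refine VNmod.of_finiteIndex (H ⊓ C) (c := c + 1) ?_
  rw [lcs_succ, Subgroup.commutator_le]
  intro a ha g hg
  have h1 : a ∈ A := hc (lcs_mono inf_le_left c ha)
  have h2 : MulAut.conjNormal g = (1 : MulAut A) := hg.2
  have h3 := congrArg Subtype.val (DFunLike.congr_fun h2 (⟨a, h1⟩ : A))
  rw [MulAut.conjNormal_apply] at h3
  rw [Subgroup.mem_bot, commutatorElement_eq_one_iff_mul_comm]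
  exact (mul_inv_eq_iff_eq_mul.1 h3).symm

end UniformGrowth

namespace UniformGrowth

open scoped Pointwise commutatorElement

variable {G : Type*} [Group G]

lemma finite_commutatorSet_of_finite_quotient_center [Finite (G ⧸ Subgroup.center G)] :
    Finite (commutatorSet G) := by
  refine Set.Finite.subset (Set.finite_range fun p : (G ⧸ Subgroup.center G) ×
    (G ⧸ Subgroup.center G) => ⁅p.1.out, p.2.out⁆) ?_
  rintro _ ⟨x, y, rfl⟩
  have key : ∀ g : G, ∃ z ∈ Subgroup.center G, g = (g : G ⧸ Subgroup.center G).out * z := by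
    intro g
    refine ⟨(g : G ⧸ Subgroup.center G).out⁻¹ * g, ?_, by group⟩
    rw [← QuotientGroup.eq, QuotientGroup.out_eq']
  obtain ⟨z, hz, hx⟩ := key x
  obtain ⟨w, hw, hy⟩ := key y
  refine ⟨(x, y), ?_⟩
  set x' := (x : G ⧸ Subgroup.center G).out
  set y' := (y : G ⧸ Subgroup.center G).out
  change ⁅x', y'⁆ = ⁅x, y⁆
  rw [hx, hy]
  have hz' := fun g => Subgroup.mem_center_iff.1 hz g
  have hw' := fun g => Subgroup.mem_center_iff.1 hw g
  symm
  calc ⁅x' * z, y' * w⁆ = x' * (z * (y' * w * z⁻¹)) * x'⁻¹ * w⁻¹ * y'⁻¹ := by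
        simp [commutatorElement_def, mul_assoc]
    _ = x' * y' * (w * x'⁻¹) * w⁻¹ * y'⁻¹ := by rw [← hz' (y' * w * z⁻¹)]; simp [mul_assoc]
    _ = ⁅x', y'⁆ := by rw [← hw']; simp [commutatorElement_def, mul_assoc]

lemma finite_of_nilpotent_of_torsion_generators (Q : Type*) [Group Q] [Group.IsNilpotent Q] :
    ∀ S : Set Q, S.Finite → Subgroup.closure S = ⊤ → (∀ s ∈ S, IsOfFinOrder s) → Finite Q := by
  refine Group.nilpotent_center_quotient_ind (P := fun Q _ _ => ∀ S : Set Q, S.Finite →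
    Subgroup.closure S = ⊤ → (∀ s ∈ S, IsOfFinOrder s) → Finite Q) Q ?_ ?_
  · intros
    infer_instance
  · intro Q _ _ ih S hS hcl htor
    have h1 : Finite (Q ⧸ Subgroup.center Q) := by
      refine ih (QuotientGroup.mk' _ '' S) (hS.image _) ?_ ?_
      · rw [← MonoidHom.map_closure, hcl, ← MonoidHom.range_eq_map, QuotientGroup.range_mk']
      · rintro _ ⟨s, hs, rfl⟩
        exact MonoidHom.isOfFinOrder _ (htor s hs)
    have h2 : Finite (commutatorSet Q) := finite_commutatorSet_of_finite_quotient_center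
    have hfg : Group.FG Q := Group.fg_iff.2 ⟨S, hcl, hS⟩
    have h3 : Finite (Abelianization Q) := by
      have : Group.FG (Abelianization Q) := QuotientGroup.fg _
      refine CommGroup.finite_of_fg_isMulTorsion _ ?_
      have h4 : Subgroup.closure (Abelianization.of '' S) ≤
          CommGroup.torsion (Abelianization Q) := by
        rw [Subgroup.closure_le]
        rintro _ ⟨s, hs, rfl⟩
        exact MonoidHom.isOfFinOrder _ (htor s hs)
      rw [← MonoidHom.map_closure, hcl, ← MonoidHom.range_eq_map] at h4
      intro x
      obtain ⟨y, rfl⟩ := QuotientGroup.mk'_surjective _ x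
      exact h4 ⟨y, rfl⟩
    have h5 : Finite (Q ⧸ commutator Q) := h3
    exact Finite.of_subgroup_quotient (commutator Q)

lemma commutator_pow_of_commutator_mem_center {x h : G} (hz : ⁅x, h⁆ ∈ Subgroup.center G) (r : ℕ) :
    ⁅x ^ r, h⁆ = ⁅x, h⁆ ^ r := by
  have h1 : h * x * h⁻¹ = ⁅x, h⁆⁻¹ * x := by simp [commutatorElement_def, mul_assoc]
  have h2 : Commute ⁅x, h⁆⁻¹ x := (Subgroup.mem_center_iff.1 (inv_mem hz) x).symm
  have h3 : h * x ^ r * h⁻¹ = ⁅x, h⁆⁻¹ ^ r * x ^ r := by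
    rw [← conj_pow, h1, h2.mul_pow]
  have h4 : ⁅x ^ r, h⁆ = x ^ r * (h * x ^ r * h⁻¹)⁻¹ := by
    simp [commutatorElement_def, mul_assoc]
  rw [h4, h3, mul_inv_rev, inv_pow, inv_inv, mul_inv_cancel_left]

lemma exists_pow_eq_one_of_center (r : ℕ) (hr : 0 < r) (Q : Type*) [Group Q]
    [Group.IsNilpotent Q] :
    (∀ z ∈ Subgroup.center Q, z ^ r = 1) → ∃ m, 0 < m ∧ ∀ x : Q, x ^ m = 1 := by
  refine Group.nilpotent_center_quotient_ind (P := fun Q _ _ =>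
    (∀ z ∈ Subgroup.center Q, z ^ r = 1) → ∃ m, 0 < m ∧ ∀ x : Q, x ^ m = 1) Q ?_ ?_
  · exact fun Q _ _ _ => ⟨1, one_pos, fun x => Subsingleton.elim _ _⟩
  · intro Q _ _ ih hZ
    obtain ⟨m, hm, hpow⟩ := ih (by
      intro z hz
      obtain ⟨x, rfl⟩ := QuotientGroup.mk'_surjective _ z
      rw [← map_pow, QuotientGroup.mk'_apply, QuotientGroup.eq_one_iff, Subgroup.mem_center_iff]
      intro h
      have h1 : ⁅x, h⁆ ∈ Subgroup.center Q := by
        rw [← QuotientGroup.eq_one_iff]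
        exact commutatorElement_eq_one_iff_mul_comm.2
          (Subgroup.mem_center_iff.1 hz (h : Q ⧸ Subgroup.center Q)).symm
      exact (commutatorElement_eq_one_iff_mul_comm.1
        ((commutator_pow_of_commutator_mem_center h1 r).trans (hZ _ h1))).symm)
    refine ⟨m * r, by positivity, fun x => ?_⟩
    rw [pow_mul]
    refine hZ _ ?_
    rw [← QuotientGroup.eq_one_iff]
    exact hpow x

end UniformGrowth

namespace UniformGrowth

open scoped Pointwise commutatorElement

variable {G : Type*} [Group G]

lemma isNilpotent_of_lcs_eq_bot {c : ℕ} (h : lcs (⊤ : Subgroup G) c = ⊥) :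
    Group.IsNilpotent G :=
  Subgroup.nilpotent_iff_lowerCentralSeries.2 ⟨c, h⟩

section Schur

variable {V : Type*} [AddCommGroup V] [Module ℂ V] [Nontrivial V]

/-- The elements acting by scalars. -/
def scalarSubgroup (τ : G →* Module.End ℂ V) : Subgroup G where
  carrier := {g | ∃ μ : ℂ, τ g = μ • 1}
  one_mem' := ⟨1, by simp⟩
  mul_mem' := by
    rintro a b ⟨μ, hμ⟩ ⟨ν, hν⟩
    exact ⟨μ * ν, by rw [map_mul, hμ, hν, smul_mul_smul_comm, one_mul]⟩
  inv_mem' := by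
    rintro a ⟨μ, hμ⟩
    have h1 : μ • τ a⁻¹ = 1 := by
      rw [← map_one τ, ← mul_inv_cancel a, map_mul, hμ, smul_mul_assoc, one_mul]
    have h0 : μ ≠ 0 := by
      rintro rfl
      rw [zero_smul] at h1
      exact zero_ne_one h1
    exact ⟨μ⁻¹, by rw [← h1, smul_smul, inv_mul_cancel₀ h0, one_smul]⟩

instance (τ : G →* Module.End ℂ V) : (scalarSubgroup τ).Normal := ⟨by
  rintro a ⟨μ, hμ⟩ g
  refine ⟨μ, ?_⟩
  rw [map_mul, map_mul, hμ, mul_smul_comm, smul_mul_assoc, mul_one, ← map_mul, mul_inv_cancel,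
    map_one]⟩

variable [FiniteDimensional ℂ V]

lemma exists_eq_smul_one_of_commute (τ : G →* Module.End ℂ V)
    (hirr : ∀ U : Submodule ℂ V, (∀ g, ∀ u ∈ U, τ g u ∈ U) → U = ⊥ ∨ U = ⊤)
    (A : Module.End ℂ V) (hA : ∀ g, Commute A (τ g)) : ∃ μ : ℂ, A = μ • 1 := by
  obtain ⟨μ, hμ⟩ := Module.End.exists_eigenvalue A
  refine ⟨μ, ?_⟩
  rcases hirr (A.eigenspace μ) (fun g u hu => by
    rw [Module.End.mem_eigenspace_iff] at *
    have := LinearMap.congr_fun (hA g).eq u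
    simp only [Module.End.mul_apply] at this
    rw [this, hu, map_smul]) with h | h
  · exact absurd h hμ
  · ext v
    have : v ∈ A.eigenspace μ := h ▸ Submodule.mem_top
    simpa using Module.End.mem_eigenspace_iff.1 this

lemma exists_pow_mem_scalarSubgroup (τ : G →* Module.End ℂ V)
    (hirr : ∀ U : Submodule ℂ V, (∀ g, ∀ u ∈ U, τ g u ∈ U) → U = ⊥ ∨ U = ⊤)
    {c : ℕ} (hc : lcs (⊤ : Subgroup G) c ≤ τ.ker) :
    ∃ m, 0 < m ∧ ∀ g : G, g ^ m ∈ scalarSubgroup τ := by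
  set Z := scalarSubgroup τ with hZ
  have hnil : Group.IsNilpotent (G ⧸ Z) := by
    refine isNilpotent_of_lcs_eq_bot (c := c) ?_
    have h1 : (⊤ : Subgroup (G ⧸ Z)) = (⊤ : Subgroup G).map (QuotientGroup.mk' Z) := by
      rw [← MonoidHom.range_eq_map, QuotientGroup.range_mk']
    rw [h1, ← map_lcs, Subgroup.map_eq_bot_iff, QuotientGroup.ker_mk']
    exact hc.trans fun g hg => ⟨1, by rw [one_smul]; exact hg⟩
  obtain ⟨m, hm, h⟩ := exists_pow_eq_one_of_center (Module.finrank ℂ V) Module.finrank_pos (G ⧸ Z)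
    (by
      intro z hz
      obtain ⟨x, rfl⟩ := QuotientGroup.mk'_surjective _ z
      rw [← map_pow, QuotientGroup.mk'_apply, QuotientGroup.eq_one_iff]
      refine exists_eq_smul_one_of_commute τ hirr _ fun h => ?_
      have h1 : ⁅x, h⁆ ∈ Z := by
        rw [← QuotientGroup.eq_one_iff]
        exact commutatorElement_eq_one_iff_mul_comm.2
          (Subgroup.mem_center_iff.1 hz (h : G ⧸ Z)).symm
      obtain ⟨ζ, hζ⟩ := h1
      have hdet : ζ ^ Module.finrank ℂ V = 1 := by
        have h2 : LinearMap.det (τ ⁅x, h⁆) = 1 := by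
          let u := ((LinearMap.det : Module.End ℂ V →* ℂ).comp τ).toHomUnits
          have h3 : ⁅u x, u h⁆ = 1 := commutatorElement_eq_one_iff_mul_comm.2 (mul_comm _ _)
          exact congrArg Units.val ((map_commutatorElement u x h).trans h3)
        rwa [hζ, LinearMap.det_smul, map_one, mul_one] at h2
      have hcomm : τ x * τ h = ζ • (τ h * τ x) := by
        rw [← map_mul, show x * h = ⁅x, h⁆ * (h * x) by simp [commutatorElement_def, mul_assoc],
          map_mul, hζ, smul_mul_assoc, one_mul, map_mul]
      have hk : ∀ k : ℕ, τ x ^ k * τ h = ζ ^ k • (τ h * τ x ^ k) := by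
        intro k
        induction k with
        | zero => simp
        | succ k ih =>
          rw [pow_succ, mul_assoc, hcomm, mul_smul_comm, ← mul_assoc, ih, smul_mul_assoc,
            smul_smul, mul_assoc, ← pow_succ, pow_succ' ζ]
      rw [map_pow]
      have := hk (Module.finrank ℂ V)
      rwa [hdet, one_smul] at this)
  exact ⟨m, hm, fun g => (QuotientGroup.eq_one_iff _).1 (h (g : G ⧸ Z))⟩

end Schur

end UniformGrowth

namespace UniformGrowth

open Polynomial

/-- The polynomial `∑ X ^ j` over the positions `j`, counted from the end, of `true` in `v`. -/
noncomputable def valPoly : List Bool → ℤ[X]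
  | [] => 0
  | e :: v => cond e (X ^ v.length) 0 + valPoly v

lemma norm_aeval_valPoly_sub_le {z : ℂ} (hz : 2 ≤ ‖z‖) (v w : List Bool)
    (h : v.length = w.length) :
    ‖aeval z (valPoly v) - aeval z (valPoly w)‖ ≤ ‖z‖ ^ v.length - 1 := by
  induction v generalizing w with
  | nil =>
    obtain rfl : w = [] := List.length_eq_zero_iff.1 h.symm
    simp
  | cons a v ih =>
    cases w with
    | nil => simp at h
    | cons b w =>
      simp only [List.length_cons, Nat.add_right_cancel_iff] at h
      have h1 := ih w h
      have h2 : ‖aeval z (cond a (X ^ v.length) 0 : ℤ[X]) -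
          aeval z (cond b (X ^ w.length) 0 : ℤ[X])‖ ≤ ‖z‖ ^ v.length := by
        cases a <;> cases b <;> simp [h]
      have h3 : aeval z (valPoly (a :: v)) - aeval z (valPoly (b :: w)) =
          (aeval z (cond a (X ^ v.length) 0 : ℤ[X]) - aeval z (cond b (X ^ w.length) 0 : ℤ[X])) +
          (aeval z (valPoly v) - aeval z (valPoly w)) := by
        simp only [valPoly, map_add]; ring
      have h4 : 0 ≤ ‖z‖ ^ v.length := by positivity
      rw [h3, List.length_cons, pow_succ]
      refine (norm_add_le _ _).trans ?_
      nlinarith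

lemma norm_lt_two_of_aeval_valPoly_eq {z : ℂ} {v w : List Bool} (h : v.length = w.length)
    (he : aeval z (valPoly v) = aeval z (valPoly w)) (hne : v ≠ w) : ‖z‖ < 2 := by
  by_contra! hz
  induction v generalizing w with
  | nil => exact hne (List.length_eq_zero_iff.1 h.symm).symm
  | cons a v ih =>
    cases w with
    | nil => simp at h
    | cons b w =>
      simp only [List.length_cons, Nat.add_right_cancel_iff] at h
      simp only [valPoly, map_add] at he
      have h1 := norm_aeval_valPoly_sub_le hz v w h
      have key : ∀ x y : ℂ, z ^ v.length + x = y → ‖x - y‖ ≤ ‖z‖ ^ v.length - 1 → False := by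
        rintro x y rfl hxy
        rw [sub_add_cancel_right, norm_neg, norm_pow] at hxy
        linarith
      by_cases hab : a = b
      · subst hab
        rw [h] at he
        exact ih h (add_left_cancel he) fun h => hne (by rw [h])
      · cases a <;> cases b
        · exact hab rfl
        · simp only [cond_false, cond_true, map_zero, zero_add, map_pow, aeval_X] at he
          rw [← h] at he
          exact key _ _ he.symm (by rwa [norm_sub_rev])
        · simp only [cond_false, cond_true, map_zero, zero_add, map_pow, aeval_X] at he
          exact key _ _ he h1
        · exact hab rfl

lemma prod_map_max_one_pow_le (s : Multiset ℂ) (K : ℕ) (h : ∀ a ∈ s, ‖a‖ ^ K ≤ 2) :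
    (s.map fun a => max 1 ‖a‖).prod ^ K ≤ 2 ^ s.card := by
  induction s using Multiset.induction with
  | empty => simp
  | cons a s ih =>
    rw [Multiset.map_cons, Multiset.prod_cons, mul_pow, Multiset.card_cons, pow_succ']
    have h1 : max 1 ‖a‖ ^ K ≤ 2 := by
      rcases max_cases 1 ‖a‖ with h' | h'
      · rw [h'.1, one_pow]
        exact one_le_two
      · rw [h'.1]
        exact h a (Multiset.mem_cons_self a s)
    have h2 := ih fun b hb => h b (Multiset.mem_cons_of_mem hb)
    have h3 : 0 ≤ (s.map fun a => max 1 ‖a‖).prod := Multiset.prod_nonneg fun x hx => by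
      obtain ⟨b, -, rfl⟩ := Multiset.mem_map.1 hx
      positivity
    exact mul_le_mul h1 h2 (pow_nonneg h3 K) zero_le_two

lemma exists_forall_pow_eq_one (n : ℕ) : ∃ K, 0 < K ∧ ∀ lam : ℂ, lam ≠ 0 → IsIntegral ℤ lam →
    (minpoly ℤ lam).natDegree ≤ n → ∀ v w : List Bool, v.length = w.length → v ≠ w →
    aeval (lam ^ K) (valPoly v) = aeval (lam ^ K) (valPoly w) → ∃ k, 0 < k ∧ lam ^ k = 1 := by
  set F : Set ℤ[X] := {p | p.natDegree ≤ n ∧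
    (p.map (Int.castRingHom ℂ)).mahlerMeasure ≤ ((2 ^ n : NNReal) : ℝ)} with hF
  have hfin : F.Finite := Polynomial.finite_mahlerMeasure_le n (2 ^ n)
  have hK : ∃ K, 0 < K ∧ ∀ p ∈ F, 1 < (p.map (Int.castRingHom ℂ)).mahlerMeasure →
      (2 : ℝ) ^ n < (p.map (Int.castRingHom ℂ)).mahlerMeasure ^ K := by
    have h1 : ∀ p ∈ F, ∀ᶠ K : ℕ in Filter.atTop, 1 < (p.map (Int.castRingHom ℂ)).mahlerMeasure →
        (2 : ℝ) ^ n < (p.map (Int.castRingHom ℂ)).mahlerMeasure ^ K := by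
      intro p _
      by_cases h : 1 < (p.map (Int.castRingHom ℂ)).mahlerMeasure
      · filter_upwards [(tendsto_pow_atTop_atTop_of_one_lt h).eventually_gt_atTop _] with K hK _
        exact hK
      · exact Filter.Eventually.of_forall fun K h' => absurd h' h
    obtain ⟨K, hK1, hK2⟩ :=
      (((hfin.eventually_all).2 h1).and (Filter.eventually_gt_atTop 0)).exists
    exact ⟨K, hK2, hK1⟩
  obtain ⟨K, hK0, hK⟩ := hK
  refine ⟨K, hK0, fun lam h0 hint hdeg v w hl hne he => ?_⟩
  set p := minpoly ℤ lam with hp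
  have hmonic : p.Monic := minpoly.monic hint
  have hdvd : p ∣ (valPoly v - valPoly w).comp (X ^ K) := by
    refine minpoly.isIntegrallyClosed_dvd hint ?_
    rw [aeval_comp, map_pow, aeval_X, map_sub, he, sub_self]
  have hroot : ∀ a ∈ (p.map (Int.castRingHom ℂ)).roots, ‖a‖ ^ K < 2 := by
    intro a ha
    have h1 : aeval a p = 0 := by
      have := (mem_roots'.1 ha).2
      rwa [IsRoot.def, eval_map, ← algebraMap_int_eq, ← aeval_def] at this
    obtain ⟨q, hq⟩ := hdvd
    have h2 : aeval a ((valPoly v - valPoly w).comp (X ^ K)) = 0 := by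
      rw [hq, map_mul, h1, zero_mul]
    rw [aeval_comp, map_pow, aeval_X, map_sub, sub_eq_zero] at h2
    rw [← norm_pow]
    exact norm_lt_two_of_aeval_valPoly_eq hl h2 hne
  set M := (p.map (Int.castRingHom ℂ)).mahlerMeasure with hM
  have hMprod : M = ((p.map (Int.castRingHom ℂ)).roots.map fun a => max 1 ‖a‖).prod := by
    rw [hM, mahlerMeasure_eq_leadingCoeff_mul_prod_roots, (hmonic.map _).leadingCoeff, norm_one,
      one_mul]
  have hM1 : 1 ≤ M := one_le_mahlerMeasure_of_ne_zero hmonic.ne_zero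
  have hMK : M ^ K ≤ 2 ^ n := by
    rw [hMprod]
    refine (prod_map_max_one_pow_le _ K fun a ha => (hroot a ha).le).trans ?_
    refine pow_le_pow_right₀ one_le_two ?_
    exact (card_roots' _).trans (natDegree_map_le.trans hdeg)
  have hMle : M ≤ 2 ^ n := (le_self_pow₀ hM1 hK0.ne').trans hMK
  have hpF : p ∈ F := ⟨hdeg, by push_cast; exact hMle⟩
  have hM2 : M = 1 := by
    by_contra h
    exact absurd hMK (not_le.2 (hK p hpF (lt_of_le_of_ne hM1 (Ne.symm h))))
  exact Polynomial.pow_eq_one_of_mahlerMeasure_eq_one hM2 h0 (by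
    rw [mem_aroots, hp]
    exact ⟨hmonic.ne_zero, minpoly.aeval ℤ lam⟩)

end UniformGrowth

namespace UniformGrowth

open Polynomial

variable {G : Type*} [Group G]

/-- The action of a group on the functions on it induced by conjugation. -/
def conjRep (G : Type*) [Group G] : G →* Module.End ℂ (G → ℂ) where
  toFun g := LinearMap.funLeft ℂ ℂ fun x => g⁻¹ * x * g
  map_one' := by ext f x; simp [LinearMap.funLeft_apply]
  map_mul' g h := by
    refine LinearMap.ext fun f => funext fun x => ?_
    simp [LinearMap.funLeft_apply, mul_assoc]

@[simp] lemma conjRep_apply (g : G) (f : G → ℂ) (x : G) :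
    conjRep G g f x = f (g⁻¹ * x * g) := rfl

/-- A conjugation invariant space of functions supported on `N` and additive there. -/
structure CharSpace (N : Subgroup G) (W : Submodule ℂ (G → ℂ)) : Prop where
  add : ∀ f ∈ W, ∀ x ∈ N, ∀ y ∈ N, f (x * y) = f x + f y
  supp : ∀ f ∈ W, ∀ x ∉ N, f x = 0
  inv : ∀ g, ∀ f ∈ W, conjRep G g f ∈ W

section AdditiveOn

variable {N : Subgroup G} {f : G → ℂ}

lemma additive_one (hf : ∀ x ∈ N, ∀ y ∈ N, f (x * y) = f x + f y) : f 1 = 0 := by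
  simpa using hf 1 (one_mem N) 1 (one_mem N)

lemma additive_inv (hf : ∀ x ∈ N, ∀ y ∈ N, f (x * y) = f x + f y)
    {x : G} (hx : x ∈ N) : f x⁻¹ = -f x := by
  have := hf x hx x⁻¹ (inv_mem hx)
  rw [mul_inv_cancel, additive_one hf] at this
  linear_combination -this

lemma additive_conj (hf : ∀ x ∈ N, ∀ y ∈ N, f (x * y) = f x + f y) {a x : G}
    (ha : a ∈ N) (hx : x ∈ N) : f (a⁻¹ * x * a) = f x := by
  rw [hf _ (mul_mem (inv_mem ha) hx) _ ha, hf _ (inv_mem ha) _ hx, additive_inv hf ha]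
  ring

lemma exists_natDegree_minpoly_le (hf : ∀ x ∈ N, ∀ y ∈ N, f (x * y) = f x + f y)
    (hN : N.FG) (h0 : ∃ x ∈ N, f x ≠ 0) :
    ∃ n, ∀ (g : G) (lam : ℂ), (∀ x ∈ N, g⁻¹ * x * g ∈ N) →
      (∀ x ∈ N, f (g⁻¹ * x * g) = lam * f x) →
      IsIntegral ℤ lam ∧ (minpoly ℤ lam).natDegree ≤ n := by
  set M : Submodule ℤ ℂ := Submodule.span ℤ (f '' N) with hM
  have hfin : Module.Finite ℤ M := by
    obtain ⟨T, hT⟩ := hN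
    rw [Module.Finite.iff_fg]
    refine ⟨T.image f, le_antisymm ?_ ?_⟩
    · refine Submodule.span_mono ?_
      rw [Finset.coe_image]
      exact Set.image_mono (hT ▸ Subgroup.subset_closure)
    · rw [hM, Submodule.span_le]
      rintro _ ⟨x, hx, rfl⟩
      have hTN : ∀ y, y ∈ Subgroup.closure (T : Set G) → y ∈ N := fun y hy => hT ▸ hy
      rw [← hT] at hx
      induction hx using Subgroup.closure_induction with
      | mem y hy => exact Submodule.subset_span (by simpa using ⟨y, hy, rfl⟩)
      | one => rw [additive_one hf]; exact zero_mem _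
      | mul y z hy hz h1 h2 => rw [hf y (hTN y hy) z (hTN z hz)]; exact add_mem h1 h2
      | inv y hy h1 => rw [additive_inv hf (hTN y hy)]; exact neg_mem h1
  refine ⟨Module.finrank ℤ M, fun g lam hg h => ?_⟩
  have hmaps : ∀ z ∈ M, LinearMap.mulLeft ℤ lam z ∈ M := by
    intro z hz
    induction hz using Submodule.span_induction with
    | mem z hz =>
      obtain ⟨x, hx, rfl⟩ := hz
      rw [LinearMap.mulLeft_apply, ← h x hx]
      exact Submodule.subset_span ⟨_, hg x hx, rfl⟩
    | zero => rw [map_zero]; exact zero_mem _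
    | add x y _ _ h1 h2 => rw [map_add]; exact add_mem h1 h2
    | smul a x _ h1 => rw [map_smul]; exact Submodule.smul_mem _ a h1
  set A : Module.End ℤ M := (LinearMap.mulLeft ℤ lam).restrict hmaps with hA
  have key : ∀ (p : ℤ[X]) (z : M), ((aeval A p z : M) : ℂ) = aeval lam p * z := by
    intro p
    induction p using Polynomial.induction_on' with
    | add p q hp hq => intro z; simp [hp, hq, add_mul]
    | monomial n a =>
      intro z
      have h1 : ∀ n : ℕ, (((A ^ n) z : M) : ℂ) = lam ^ n * z := by
        intro n
        induction n with
        | zero => simp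
        | succ n ih =>
          rw [pow_succ', Module.End.mul_apply, hA, LinearMap.restrict_apply]
          simp only [LinearMap.mulLeft_apply]
          rw [← hA, ih]
          ring
      simp [aeval_monomial, h1, mul_assoc]
  obtain ⟨x, hx, hx0⟩ := h0
  have h2 : aeval lam A.charpoly = 0 := by
    have h3 := key A.charpoly ⟨f x, Submodule.subset_span ⟨x, hx, rfl⟩⟩
    rw [LinearMap.aeval_self_charpoly] at h3
    exact (mul_eq_zero.1 h3.symm).resolve_right hx0
  have hint : IsIntegral ℤ lam := ⟨A.charpoly, A.charpoly_monic, h2⟩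
  refine ⟨hint, ?_⟩
  rw [← A.charpoly_natDegree]
  exact natDegree_le_of_dvd (minpoly.isIntegrallyClosed_dvd hint h2) A.charpoly_monic.ne_zero

lemma wordEval_eq_pow_mul [N.Normal]
    (hf : ∀ x ∈ N, ∀ y ∈ N, f (x * y) = f x + f y) {t y : G} (hy : y ∈ N) {μ : ℂ}
    (hμ : ∀ x ∈ N, f (t⁻¹ * x * t) = μ * f x) (v : List Bool) :
    ∃ b ∈ N, wordEval t (t * y) v = t ^ v.length * b ∧ f b = aeval μ (valPoly v) * f y := by
  have hconj : ∀ x ∈ N, t⁻¹ * x * t ∈ N := fun x hx => by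
    simpa using Subgroup.Normal.conj_mem ‹N.Normal› x hx t⁻¹
  have hpow : ∀ n : ℕ, (t ^ n)⁻¹ * y * t ^ n ∈ N ∧ f ((t ^ n)⁻¹ * y * t ^ n) = μ ^ n * f y := by
    intro n
    induction n with
    | zero => simpa using hy
    | succ n ih =>
      have h1 : (t ^ (n + 1))⁻¹ * y * t ^ (n + 1) = t⁻¹ * ((t ^ n)⁻¹ * y * t ^ n) * t := by
        rw [pow_succ]; group
      rw [h1]
      refine ⟨hconj _ ih.1, ?_⟩
      rw [hμ _ ih.1, ih.2, pow_succ']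
      ring
  induction v with
  | nil => exact ⟨1, one_mem N, by simp, by simp [valPoly, additive_one hf]⟩
  | cons e v ih =>
    obtain ⟨b, hb, h1, h2⟩ := ih
    cases e
    · exact ⟨b, hb, by simp [h1, pow_succ', mul_assoc], by simp [valPoly, h2]⟩
    · obtain ⟨h3, h4⟩ := hpow v.length
      refine ⟨(t ^ v.length)⁻¹ * y * t ^ v.length * b, mul_mem h3 hb, ?_, ?_⟩
      · simp [h1, pow_succ', mul_assoc]
      · rw [hf _ h3 _ hb, h4, h2]
        simp [valPoly]
        ring

lemma aeval_valPoly_eq_of_wordEval_eq [N.Normal]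
    (hf : ∀ x ∈ N, ∀ y ∈ N, f (x * y) = f x + f y) {t y : G} (hy : y ∈ N) (hy0 : f y ≠ 0) {μ : ℂ}
    (hμ : ∀ x ∈ N, f (t⁻¹ * x * t) = μ * f x) {v w : List Bool} (hl : v.length = w.length)
    (he : wordEval t (t * y) v = wordEval t (t * y) w) :
    aeval μ (valPoly v) = aeval μ (valPoly w) := by
  obtain ⟨b, -, h1, h2⟩ := wordEval_eq_pow_mul hf hy hμ v
  obtain ⟨b', -, h3, h4⟩ := wordEval_eq_pow_mul hf hy hμ w
  rw [h1, h3, hl, mul_right_inj] at he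
  rw [he, h4] at h2
  exact (mul_right_cancel₀ hy0 h2).symm

end AdditiveOn

end UniformGrowth

namespace UniformGrowth

open Polynomial
open scoped Pointwise commutatorElement

variable {G : Type*} [Group G]

/-- The common zeros in `N` of the functions in `W`. -/
def CharSpace.zeros {N : Subgroup G} {W : Submodule ℂ (G → ℂ)} (h : CharSpace N W) :
    Subgroup G where
  carrier := {x | x ∈ N ∧ ∀ f ∈ W, f x = 0}
  one_mem' := ⟨one_mem N, fun f hf => additive_one (h.add f hf)⟩
  mul_mem' := by
    rintro x y ⟨hx, hx0⟩ ⟨hy, hy0⟩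
    exact ⟨mul_mem hx hy, fun f hf => by rw [h.add f hf x hx y hy, hx0 f hf, hy0 f hf, add_zero]⟩
  inv_mem' := by
    rintro x ⟨hx, hx0⟩
    exact ⟨inv_mem hx, fun f hf => by rw [additive_inv (h.add f hf) hx, hx0 f hf, neg_zero]⟩

namespace CharSpace

variable {N : Subgroup G} {W : Submodule ℂ (G → ℂ)}

lemma zeros_normal [N.Normal] (h : CharSpace N W) : h.zeros.Normal := ⟨by
  rintro x ⟨hx, hx0⟩ g
  refine ⟨Subgroup.Normal.conj_mem inferInstance x hx g, fun f hf => ?_⟩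
  simpa using hx0 _ (h.inv g⁻¹ f hf)⟩

lemma exists_ne_zero (h : CharSpace N W) {f : G → ℂ} (hf : f ∈ W) (h0 : f ≠ 0) :
    ∃ x ∈ N, f x ≠ 0 := by
  by_contra! h1
  refine h0 (funext fun x => ?_)
  by_cases hx : x ∈ N
  · exact h1 x hx
  · exact h.supp f hf x hx

/-- The action of `G` on an invariant space of functions. -/
def rep (h : CharSpace N W) : G →* Module.End ℂ W where
  toFun g := (conjRep G g).restrict (h.inv g)
  map_one' := by ext f; simp
  map_mul' a b := by ext f; simp

@[simp] lemma coe_rep (h : CharSpace N W) (g : G) (f : W) :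
    ((h.rep g f : W) : G → ℂ) = conjRep G g f := rfl

lemma le_ker_rep [N.Normal] (h : CharSpace N W) : N ≤ h.rep.ker := by
  intro a ha
  rw [MonoidHom.mem_ker]
  refine LinearMap.ext fun f => Subtype.ext (funext fun x => ?_)
  rw [coe_rep, conjRep_apply, Module.End.one_apply]
  by_cases hx : x ∈ N
  · exact additive_conj (h.add f f.2) ha hx
  · rw [h.supp f f.2 x hx, h.supp f f.2]
    intro h1
    have := Subgroup.Normal.conj_mem inferInstance _ h1 a
    exact hx (by simpa [mul_assoc] using this)

lemma eq_of_mem_ker (h : CharSpace N W) {g : G} (hg : g ∈ h.rep.ker) {f : G → ℂ} (hf : f ∈ W)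
    (x : G) : f (g⁻¹ * x * g) = f x := by
  have h1 := LinearMap.congr_fun (MonoidHom.mem_ker.1 hg) (⟨f, hf⟩ : W)
  exact congrFun (congrArg Subtype.val h1) x

lemma commutator_ker_le_zeros [N.Normal] (h : CharSpace N W) : ⁅N, h.rep.ker⁆ ≤ h.zeros := by
  rw [Subgroup.commutator_le]
  intro a ha g hg
  have hg' : g * a⁻¹ * g⁻¹ ∈ N := Subgroup.Normal.conj_mem inferInstance _ (inv_mem ha) g
  have hag : ⁅a, g⁆ = a * (g * a⁻¹ * g⁻¹) := by simp [commutatorElement_def, mul_assoc]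
  rw [hag]
  refine ⟨mul_mem ha hg', fun f hf => ?_⟩
  have h1 := h.eq_of_mem_ker (inv_mem hg) hf a⁻¹
  rw [inv_inv] at h1
  rw [h.add f hf a ha _ hg', h1, additive_inv (h.add f hf) ha, add_neg_cancel]

/-- A nonzero invariant subspace of minimal dimension. -/
lemma exists_irreducible [FiniteDimensional ℂ W] (h : CharSpace N W) (h0 : W ≠ ⊥) :
    ∃ U ≤ W, U ≠ ⊥ ∧ ∃ hU : CharSpace N U,
      ∀ P : Submodule ℂ U, (∀ g, ∀ u ∈ P, hU.rep g u ∈ P) → P = ⊥ ∨ P = ⊤ := by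
  obtain ⟨U, ⟨hUW, hU0, hU⟩, hmin⟩ := (measure fun U : Submodule ℂ (G → ℂ) =>
    Module.finrank ℂ U).wf.has_min {U | U ≤ W ∧ U ≠ ⊥ ∧ CharSpace N U} ⟨W, le_rfl, h0, h⟩
  have hfd : FiniteDimensional ℂ U := Submodule.finiteDimensional_of_le hUW
  refine ⟨U, hUW, hU0, hU, fun P hP => or_iff_not_imp_left.2 fun hP0 => ?_⟩
  have hPU : P.map U.subtype ≤ U := Submodule.map_subtype_le U P
  have h1 := hmin (P.map U.subtype) ⟨hPU.trans hUW, ?_, ?_⟩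
  · have h2 : P.map U.subtype = U :=
      Submodule.eq_of_le_of_finrank_le hPU (not_lt.1 h1)
    refine Submodule.map_injective_of_injective U.injective_subtype ?_
    rw [h2, Submodule.map_subtype_top]
  · exact fun h1 => hP0 (Submodule.map_injective_of_injective U.injective_subtype
      (h1.trans (Submodule.map_bot _).symm))
  · refine ⟨fun f hf => hU.add f (hPU hf), fun f hf => hU.supp f (hPU hf), ?_⟩
    rintro g _ ⟨f, hf, rfl⟩
    exact ⟨hU.rep g f, hP g f hf, rfl⟩

lemma finiteIndex_ker_rep (hG : ZeroEnt G) {c : ℕ} {U : Submodule ℂ (G → ℂ)}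
    [FiniteDimensional ℂ U] (h : CharSpace (lcs (⊤ : Subgroup G) c) U) (h0 : U ≠ ⊥)
    (hirr : ∀ P : Submodule ℂ U, (∀ g, ∀ u ∈ P, h.rep g u ∈ P) → P = ⊥ ∨ P = ⊤) :
    h.rep.ker.FiniteIndex := by
  have hnormal := lcs_normal (⊤ : Subgroup G) c
  have hnt : Nontrivial U := Submodule.nontrivial_iff_ne_bot.2 h0
  obtain ⟨m, hm, hscalar⟩ := exists_pow_mem_scalarSubgroup h.rep hirr h.le_ker_rep
  obtain ⟨f, hf, hf0⟩ := Submodule.exists_mem_ne_zero_of_ne_bot h0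
  obtain ⟨n, hn⟩ := exists_natDegree_minpoly_le (h.add f hf)
    (hG.fgAbove_lcs_top c _ le_rfl) (h.exists_ne_zero hf hf0)
  obtain ⟨K, hK, hroot⟩ := exists_forall_pow_eq_one n
  obtain ⟨S, hS, hfree⟩ := hG (m * K + commLen c)
  have htor : ∀ s ∈ S, ∃ k, 0 < k ∧ s ^ k ∈ h.rep.ker := by
    intro s hs
    obtain ⟨lam, hlam⟩ := hscalar s
    have hlam' : ∀ φ ∈ U, ∀ x, φ ((s ^ m)⁻¹ * x * s ^ m) = lam * φ x := fun φ hφ x =>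
      congrFun (congrArg Subtype.val (LinearMap.congr_fun hlam (⟨φ, hφ⟩ : U))) x
    have hlam0 : lam ≠ 0 := by
      rintro rfl
      refine hf0 (funext fun x => ?_)
      have := hlam' f hf (s ^ m * x * (s ^ m)⁻¹)
      simpa [mul_assoc] using this
    obtain ⟨hint, hdeg⟩ := hn (s ^ m) lam
      (fun x hx => by simpa using Subgroup.Normal.conj_mem hnormal x hx (s ^ m)⁻¹)
      fun x _ => hlam' f hf x
    obtain ⟨φ, hφ, y, hy, hy0⟩ : ∃ φ ∈ U, ∃ y ∈ commIter S c, φ y ≠ 0 := by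
      by_contra! hcon
      have h1 : lcs (⊤ : Subgroup G) c ≤ h.zeros := by
        have := h.zeros_normal
        refine (normalClosure_commIter hS c).symm.le.trans ?_
        refine Subgroup.normalClosure_le_normal fun y hy => ⟨?_, fun φ hφ => hcon φ hφ y hy⟩
        rw [← normalClosure_commIter hS]
        exact Subgroup.subset_normalClosure hy
      obtain ⟨x, hx, hx0⟩ := h.exists_ne_zero hf hf0
      exact hx0 ((h1 hx).2 f hf)
    have hyN : y ∈ lcs (⊤ : Subgroup G) c := by
      rw [← normalClosure_commIter hS]
      exact Subgroup.subset_normalClosure hy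
    have ht : (s ^ m) ^ K ∈ S ^ (m * K) := by
      rw [← pow_mul]
      simpa using SymmGen.pow_mem_pow (m := 1) (by simpa using hs) (m * K)
    have hnot := hfree _ (hS.pow_mono (Nat.le_add_right _ _) ht) _
      (SymmGen.mul_mem_pow ht (commIter_subset hS c hy))
    simp only [FreePair, not_forall] at hnot
    obtain ⟨v, w, hl, he, hne⟩ := hnot
    have hμ : ∀ j : ℕ, ∀ φ ∈ U, ∀ x,
        φ (((s ^ m) ^ j)⁻¹ * x * (s ^ m) ^ j) = lam ^ j * φ x := by
      intro j φ hφ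
      induction j with
      | zero => simp
      | succ j ih =>
        intro x
        have := hlam' φ hφ (((s ^ m) ^ j)⁻¹ * x * (s ^ m) ^ j)
        rw [pow_succ' lam, mul_assoc lam, ← ih x, ← this, pow_succ (s ^ m) j]
        congr 1
        group
    obtain ⟨k, hk, hk1⟩ := hroot lam hlam0 hint hdeg v w hl hne
      (aeval_valPoly_eq_of_wordEval_eq (h.add φ hφ) hyN hy0 (fun x _ => hμ K φ hφ x) hl he)
    refine ⟨m * k, by positivity, ?_⟩
    rw [MonoidHom.mem_ker]
    refine LinearMap.ext fun φ => Subtype.ext (funext fun x => ?_)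
    have := hμ k φ φ.2 x
    rwa [hk1, one_mul, ← pow_mul] at this
  have hnil : Group.IsNilpotent (G ⧸ h.rep.ker) := by
    refine isNilpotent_of_lcs_eq_bot (c := c) ?_
    rw [← QuotientGroup.range_mk' h.rep.ker, MonoidHom.range_eq_map, ← map_lcs,
      Subgroup.map_eq_bot_iff, QuotientGroup.ker_mk']
    exact h.le_ker_rep
  rw [Subgroup.finiteIndex_iff_finite_quotient]
  refine finite_of_nilpotent_of_torsion_generators _ (QuotientGroup.mk' _ '' S)
    (hS.finite.image _) ?_ ?_
  · rw [← MonoidHom.map_closure, hS.closure_eq, ← MonoidHom.range_eq_map, QuotientGroup.range_mk']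
  · rintro _ ⟨s, hs, rfl⟩
    obtain ⟨k, hk, hsk⟩ := htor s hs
    rw [isOfFinOrder_iff_pow_eq_one]
    exact ⟨k, hk, by rwa [← map_pow, QuotientGroup.mk'_apply, QuotientGroup.eq_one_iff]⟩

end CharSpace

end UniformGrowth

namespace UniformGrowth

open scoped Pointwise commutatorElement

variable {G : Type*} [Group G]

open scoped Classical in
/-- Restriction of functions to `K`, followed by truncation to `N`. -/
noncomputable def truncate (K : Subgroup G) (N : Subgroup K) : (G → ℂ) →ₗ[ℂ] (K → ℂ) where
  toFun f x := if x ∈ N then f x else 0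
  map_add' f g := by ext x; by_cases hx : x ∈ N <;> simp [hx]
  map_smul' a f := by ext x; by_cases hx : x ∈ N <;> simp [hx]

lemma truncate_of_mem {K : Subgroup G} {N : Subgroup K} (f : G → ℂ) {x : K} (hx : x ∈ N) :
    truncate K N f x = f x := if_pos hx

lemma truncate_of_notMem {K : Subgroup G} {N : Subgroup K} (f : G → ℂ) {x : K} (hx : x ∉ N) :
    truncate K N f x = 0 := if_neg hx

lemma CharSpace.truncate {N : Subgroup G} {W : Submodule ℂ (G → ℂ)} (h : CharSpace N W)
    {K : Subgroup G} {N' : Subgroup K} [N'.Normal] (hN : N'.map K.subtype ≤ N) :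
    CharSpace N' (W.map (truncate K N')) where
  add := by
    rintro _ ⟨f, hf, rfl⟩ x hx y hy
    rw [truncate_of_mem f hx, truncate_of_mem f hy, truncate_of_mem f (mul_mem hx hy)]
    exact h.add f hf _ (hN ⟨x, hx, rfl⟩) _ (hN ⟨y, hy, rfl⟩)
  supp := by
    rintro _ ⟨f, hf, rfl⟩ x hx
    exact truncate_of_notMem f hx
  inv := by
    rintro g _ ⟨f, hf, rfl⟩
    refine ⟨_, h.inv g f hf, funext fun x => ?_⟩
    rw [conjRep_apply]
    have hiff : g⁻¹ * x * g ∈ N' ↔ x ∈ N' := by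
      rw [← Subgroup.Normal.mem_comm_iff ‹N'.Normal›, mul_inv_cancel_left]
    by_cases hx : x ∈ N'
    · rw [truncate_of_mem _ hx, truncate_of_mem _ (hiff.2 hx)]
      rfl
    · rw [truncate_of_notMem _ hx, truncate_of_notMem _ (hiff.not.2 hx)]

lemma finrank_map_lt {E F : Type*} [AddCommGroup E] [Module ℂ E] [AddCommGroup F] [Module ℂ F]
    (T : E →ₗ[ℂ] F) {W : Submodule ℂ E} [FiniteDimensional ℂ W] {f : E} (hf : f ∈ W)
    (h0 : f ≠ 0) (hT : T f = 0) : Module.finrank ℂ (W.map T) < Module.finrank ℂ W := by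
  have h1 := LinearMap.finrank_range_add_finrank_ker (T.domRestrict W)
  rw [LinearMap.range_domRestrict] at h1
  have h2 : Nontrivial (LinearMap.ker (T.domRestrict W)) :=
    ⟨⟨⟨⟨f, hf⟩, hT⟩, 0, fun h => h0 (congrArg Subtype.val (congrArg Subtype.val h))⟩⟩
  have h3 : 0 < Module.finrank ℂ (LinearMap.ker (T.domRestrict W)) := Module.finrank_pos
  omega

lemma vn_of_finite_lcs {c : ℕ} (h : Finite (lcs (⊤ : Subgroup G) c)) : VN G := by
  have := lcs_normal (⊤ : Subgroup G) c
  exact VN.of_finite_normal (lcs ⊤ c) (VNmod.of_finiteIndex ⊤ le_rfl)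

lemma vn_of_charSpace (n : ℕ) : ∀ (G : Type u) [Group G], ZeroEnt G → ∀ (c : ℕ)
    (W : Submodule ℂ (G → ℂ)), FiniteDimensional ℂ W → Module.finrank ℂ W ≤ n →
    ∀ h : CharSpace (lcs (⊤ : Subgroup G) c) W, Finite h.zeros → VN G := by
  induction n with
  | zero =>
    intro G _ _ c W _ hn h hfin
    obtain rfl : W = ⊥ := Submodule.finrank_eq_zero.1 (Nat.le_zero.1 hn)
    refine vn_of_finite_lcs (c := c) (Finite.of_injective (Subgroup.inclusion
      (show lcs ⊤ c ≤ h.zeros from fun x hx => ⟨hx, fun f hf => ?_⟩))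
      (Subgroup.inclusion_injective _))
    rw [(Submodule.mem_bot ℂ).1 hf, Pi.zero_apply]
  | succ n ih =>
    intro G _ hG c W _ hn h hfin
    by_cases h0 : W = ⊥
    · subst h0
      refine vn_of_finite_lcs (c := c) (Finite.of_injective (Subgroup.inclusion
        (show lcs ⊤ c ≤ h.zeros from fun x hx => ⟨hx, fun f hf => ?_⟩))
        (Subgroup.inclusion_injective _))
      rw [(Submodule.mem_bot ℂ).1 hf, Pi.zero_apply]
    obtain ⟨U, hUW, hU0, hU, hirr⟩ := h.exists_irreducible h0
    have : FiniteDimensional ℂ U := Submodule.finiteDimensional_of_le hUW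
    have hnormal := lcs_normal (⊤ : Subgroup G) c
    set K := hU.rep.ker with hK
    have hKfi : K.FiniteIndex := hU.finiteIndex_ker_rep hG hU0 hirr
    have hle : (lcs (⊤ : Subgroup K) (c + 1)).map K.subtype ≤ hU.zeros := by
      rw [lcs_top_map_subtype]
      exact (Subgroup.commutator_mono (lcs_mono le_top c) le_rfl).trans hU.commutator_ker_le_zeros
    have hle' : (lcs (⊤ : Subgroup K) (c + 1)).map K.subtype ≤ lcs ⊤ c :=
      hle.trans fun x hx => hx.1
    have hnormal' := lcs_normal (⊤ : Subgroup K) (c + 1)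
    have h' := h.truncate hle'
    refine VN.of_subgroup K (ih K (hG.of_finiteIndex K) (c + 1) _ inferInstance ?_ h' ?_)
    · obtain ⟨f, hf, hf0⟩ := Submodule.exists_mem_ne_zero_of_ne_bot hU0
      refine Nat.lt_succ_iff.1 ((finrank_map_lt _ (hUW hf) hf0 (funext fun x => ?_)).trans_le hn)
      by_cases hx : x ∈ lcs (⊤ : Subgroup K) (c + 1)
      · rw [truncate_of_mem _ hx]
        exact (hle ⟨x, hx, rfl⟩).2 f hf
      · exact truncate_of_notMem _ hx
    · refine Finite.of_injective (β := h.zeros) (fun x => ⟨x.1, hle' ⟨x, x.2.1, rfl⟩,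
        fun f hf => ?_⟩) fun x y hxy => Subtype.ext (Subtype.ext
          (congrArg (fun z : h.zeros => (z : G)) hxy))
      rw [← truncate_of_mem f x.2.1]
      exact x.2.2 _ ⟨f, hf, rfl⟩

/-- The functions supported on `N` and additive there. -/
def additiveFunctions (N : Subgroup G) : Submodule ℂ (G → ℂ) where
  carrier := {f | (∀ x ∈ N, ∀ y ∈ N, f (x * y) = f x + f y) ∧ ∀ x ∉ N, f x = 0}
  add_mem' := by
    rintro f g ⟨hf, hf0⟩ ⟨hg, hg0⟩
    refine ⟨fun x hx y hy => ?_, fun x hx => ?_⟩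
    · simp only [Pi.add_apply, hf x hx y hy, hg x hx y hy]; ring
    · simp [hf0 x hx, hg0 x hx]
  zero_mem' := ⟨fun x _ y _ => by simp, fun x _ => rfl⟩
  smul_mem' := by
    rintro a f ⟨hf, hf0⟩
    refine ⟨fun x hx y hy => ?_, fun x hx => ?_⟩
    · simp only [Pi.smul_apply, hf x hx y hy, smul_add]
    · simp [hf0 x hx]

lemma charSpace_additiveFunctions (N : Subgroup G) [N.Normal] :
    CharSpace N (additiveFunctions N) where
  add f hf := hf.1
  supp f hf := hf.2
  inv g f hf := by
    have hiff : ∀ x, g⁻¹ * x * g ∈ N ↔ x ∈ N := fun x => by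
      rw [← Subgroup.Normal.mem_comm_iff ‹N.Normal›, mul_inv_cancel_left]
    refine ⟨fun x hx y hy => ?_, fun x hx => hf.2 _ ((hiff x).not.2 hx)⟩
    simp only [conjRep_apply]
    rw [← hf.1 _ ((hiff x).2 hx) _ ((hiff y).2 hy)]
    congr 1
    group

lemma finiteDimensional_additiveFunctions {N : Subgroup G} (hN : N.FG) :
    FiniteDimensional ℂ (additiveFunctions N) := by
  obtain ⟨T, rfl⟩ := hN
  have hinj : Function.Injective ((LinearMap.funLeft ℂ ℂ (Subtype.val : T → G)).domRestrict
      (additiveFunctions (Subgroup.closure (T : Set G)))) := by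
    rw [injective_iff_map_eq_zero]
    rintro ⟨f, hf⟩ h0
    refine Subtype.ext (funext fun x => ?_)
    by_cases hx : x ∈ Subgroup.closure (T : Set G)
    · change f x = 0
      induction hx using Subgroup.closure_induction with
      | mem x hx => exact congrFun h0 ⟨x, hx⟩
      | one => exact additive_one hf.1
      | mul x y hx hy h1 h2 => rw [hf.1 x hx y hy, h1, h2, add_zero]
      | inv x hx h1 => rw [additive_inv hf.1 hx, h1, neg_zero]
    · exact hf.2 x hx
  exact FiniteDimensional.of_injective _ hinj

lemma finite_of_forall_addMonoidHom_eq_zero {M : Type*} [AddCommGroup M] [Module.Finite ℤ M] :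
    {x : M | ∀ φ : M →+ ℂ, φ x = 0}.Finite := by
  have h1 : Finite (Submodule.torsion ℤ M) :=
    Module.finite_of_fg_torsion _ (Submodule.torsion_isTorsion)
  refine (Set.toFinite (Submodule.torsion ℤ M : Set M)).subset fun x hx => ?_
  have h2 : Module.Free ℤ (M ⧸ Submodule.torsion ℤ M) := inferInstance
  let b := Module.Free.chooseBasis ℤ (M ⧸ Submodule.torsion ℤ M)
  rw [SetLike.mem_coe, ← Submodule.Quotient.mk_eq_zero]
  refine b.ext_elem fun i => ?_
  have h3 := hx (((Int.castAddHom ℂ).comp (b.coord i).toAddMonoidHom).comp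
    (Submodule.torsion ℤ M).mkQ.toAddMonoidHom)
  rw [map_zero, Finsupp.zero_apply]
  change ((b.coord i (Submodule.Quotient.mk x) : ℤ) : ℂ) = 0 at h3
  exact_mod_cast h3

lemma finite_zeros_additiveFunctions {N : Subgroup G} [N.Normal] (hN : N.FG)
    (hcomm : ∀ x ∈ N, ∀ y ∈ N, x * y = y * x) : Finite (charSpace_additiveFunctions N).zeros := by
  let _ : CommGroup N := { (inferInstance : Group N) with
    mul_comm := fun x y => Subtype.ext (hcomm x x.2 y y.2) }
  have hfg : Module.Finite ℤ (Additive N) := by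
    rw [Module.Finite.iff_addGroup_fg, ← GroupFG.iff_add_fg, Group.fg_iff_subgroup_fg]
    exact hN
  have hfin := (finite_of_forall_addMonoidHom_eq_zero (M := Additive N)).to_subtype
  refine Finite.of_injective (β := {x : Additive N | ∀ φ : Additive N →+ ℂ, φ x = 0})
    (fun x => ⟨Additive.ofMul ⟨x.1, x.2.1⟩, fun φ => ?_⟩) ?_
  · classical
    have h1 : (fun y => if hy : y ∈ N then φ (Additive.ofMul ⟨y, hy⟩) else 0) ∈
        additiveFunctions N := by
      refine ⟨fun y hy z hz => ?_, fun y hy => dif_neg hy⟩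
      simp only [dif_pos hy, dif_pos hz, dif_pos (mul_mem hy hz)]
      exact map_add φ (Additive.ofMul ⟨y, hy⟩) (Additive.ofMul ⟨z, hz⟩)
    have h2 := x.2.2 _ h1
    rwa [dif_pos x.2.1] at h2
  · intro x y hxy
    exact Subtype.ext (congrArg (fun z : {x : Additive N | ∀ φ : Additive N →+ ℂ, φ x = 0} =>
      ((Additive.toMul z.1 : N) : G)) hxy)

lemma ZeroEnt.vn_of_lcs_comm {G : Type u} [Group G] (hG : ZeroEnt G) {c : ℕ}
    (hcomm : ∀ x ∈ lcs (⊤ : Subgroup G) c, ∀ y ∈ lcs (⊤ : Subgroup G) c, x * y = y * x) :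
    VN G := by
  have := lcs_normal (⊤ : Subgroup G) c
  have hfg := hG.fgAbove_lcs_top c _ le_rfl
  have := finiteDimensional_additiveFunctions hfg
  exact vn_of_charSpace _ G hG c _ this le_rfl (charSpace_additiveFunctions _)
    (finite_zeros_additiveFunctions hfg hcomm)

end UniformGrowth

namespace UniformGrowth

open scoped Pointwise commutatorElement

variable {G : Type*} [Group G]

/-- The property carried along the construction of `E`: if the projection to `G` of
`Γ ≤ E × G` is a normal subgroup with virtually nilpotent quotient, then so is already some normal
subgroup contained in the fibre of `Γ` over `1`. -/
def Descends (E : Type u) [Group E] : Prop :=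
  ∀ (G : Type u) [Group G], ZeroEnt G → ∀ Γ : Subgroup (E × G),
    (Γ.map (MonoidHom.snd E G)).Normal → VNmod (Γ.map (MonoidHom.snd E G)) →
      ∃ M : Subgroup G, M.Normal ∧ VNmod M ∧ ∀ n ∈ M, ((1 : E), n) ∈ Γ

lemma ZeroEnt.vnmod_commutator {G : Type u} [Group G] (hG : ZeroEnt G) {N : Subgroup G}
    [N.Normal] (hN : VNmod N) : VNmod ⁅N, N⁆ := by
  obtain ⟨H, -, hH, c, hc⟩ := hN
  set π := QuotientGroup.mk' ⁅N, N⁆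
  have hπ : Function.Surjective π := QuotientGroup.mk'_surjective _
  have hfi : (H.map π).FiniteIndex :=
    ⟨fun h => hH.index_ne_zero (Nat.eq_zero_of_zero_dvd (h ▸ H.index_map_dvd hπ))⟩
  refine VNmod.of_quotient (VN.of_subgroup (H.map π)
    (((hG.of_surjective π hπ).of_finiteIndex (H.map π)).vn_of_lcs_comm (c := c) ?_))
  have key : ∀ x ∈ lcs (⊤ : Subgroup (H.map π)) c, ∃ n ∈ N, π n = x := by
    intro x hx
    have h1 : (x : G ⧸ ⁅N, N⁆) ∈ (lcs (⊤ : Subgroup (H.map π)) c).map (H.map π).subtype :=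
      ⟨x, hx, rfl⟩
    rw [lcs_top_map_subtype, ← map_lcs] at h1
    obtain ⟨n, hn, h2⟩ := h1
    exact ⟨n, hc hn, h2⟩
  intro x hx y hy
  obtain ⟨n, hn, h1⟩ := key x hx
  obtain ⟨m, hm, h2⟩ := key y hy
  apply Subtype.ext
  rw [Subgroup.coe_mul, Subgroup.coe_mul, ← h1, ← h2, ← commutatorElement_eq_one_iff_mul_comm,
    ← map_commutatorElement]
  exact (QuotientGroup.eq_one_iff _).2 (Subgroup.commutator_mem_commutator hn hm)

lemma descends_of_comm (E : Type u) [Group E] (h : ∀ a b : E, a * b = b * a) : Descends E := by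
  intro G _ hG Γ hn hv
  refine ⟨_, inferInstance, hG.vnmod_commutator hv, ?_⟩
  have : ⁅Γ.map (MonoidHom.snd E G), Γ.map (MonoidHom.snd E G)⁆ ≤
      Γ.comap (MonoidHom.inr E G) := by
    rw [Subgroup.commutator_le]
    rintro _ ⟨⟨e, n⟩, h1, rfl⟩ _ ⟨⟨e', n'⟩, h2, rfl⟩
    have h3 : ⁅(e, n), (e', n')⁆ ∈ Γ :=
      mul_mem (mul_mem (mul_mem h1 h2) (inv_mem h1)) (inv_mem h2)
    have h4 : ⁅(e, n), (e', n')⁆ = (1, ⁅n, n'⁆) :=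
      Prod.ext (commutatorElement_eq_one_iff_mul_comm.2 (h e e')) rfl
    rw [h4] at h3
    exact h3
  exact this

lemma finite_monoidHom (N Q : Type*) [Group N] [Group Q] [Finite Q] (h : Group.FG N) :
    Finite (N →* Q) := by
  obtain ⟨S, hS⟩ := Group.fg_def.1 h
  refine Finite.of_injective (fun (f : N →* Q) (s : S) => f s) fun f g hfg => ?_
  exact MonoidHom.eq_of_eqOn_dense hS fun s hs => congrFun hfg ⟨s, hs⟩

lemma exists_characteristic_finiteIndex_le {N : Type*} [Group N] (h : Group.FG N)
    (K : Subgroup N) [K.FiniteIndex] :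
    ∃ M : Subgroup N, M.Characteristic ∧ M.FiniteIndex ∧ M ≤ K := by
  have := finite_monoidHom N (Equiv.Perm (N ⧸ K)) h
  refine ⟨⨅ f : N →* Equiv.Perm (N ⧸ K), f.ker, ?_, ?_, ?_⟩
  · rw [Subgroup.characteristic_iff_le_comap]
    intro φ x hx
    simp only [Subgroup.mem_comap, Subgroup.mem_iInf] at hx ⊢
    exact fun f => hx (f.comp φ.toMonoidHom)
  · exact Subgroup.finiteIndex_iInf fun f => inferInstance
  · refine (iInf_le _ (MulAction.toPermHom N (N ⧸ K))).trans ?_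
    rw [← Subgroup.normalCore_eq_ker]
    exact K.normalCore_le

lemma VNmod.of_finiteIndex_normal {M N : Subgroup G} [M.Normal] [N.Normal] (hN : VNmod N)
    (h : (M.subgroupOf N).FiniteIndex) : VNmod M := by
  obtain ⟨H, -, hH, c, hc⟩ := hN
  set π := QuotientGroup.mk' M
  have hπ : Function.Surjective π := QuotientGroup.mk'_surjective _
  have hfi : (H.map π).FiniteIndex :=
    ⟨fun h => hH.index_ne_zero (Nat.eq_zero_of_zero_dvd (h ▸ H.index_map_dvd hπ))⟩
  have hnorm : (N.map π).Normal := Subgroup.Normal.map inferInstance π hπ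
  have hfin : Finite (N.map π) := by
    have h1 : (π.comp N.subtype).ker = M.subgroupOf N := by
      rw [← MonoidHom.comap_ker, QuotientGroup.ker_mk']; rfl
    have h2 : (π.comp N.subtype).range = N.map π := by
      rw [MonoidHom.range_comp, Subgroup.range_subtype]
    have h3 := Subgroup.index_ker (π.comp N.subtype)
    rw [h1, h2] at h3
    exact Nat.finite_of_card_ne_zero (h3 ▸ h.index_ne_zero)
  refine VNmod.of_quotient (VN.of_finite_normal (N.map π) ?_)
  refine VNmod.of_finiteIndex (H.map π) (c := c) ?_
  rw [← map_lcs]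
  exact Subgroup.map_mono hc

lemma descends_of_finite (E : Type u) [Group E] [Finite E] : Descends E := by
  intro G _ hG Γ hn hv
  set N := Γ.map (MonoidHom.snd E G)
  have hfg : Group.FG N := by
    obtain ⟨H, -, hH, c, hc⟩ := hv
    exact (Group.fg_iff_subgroup_fg N).2 (hG.fg_of_lcs_le hc)
  set K := (Γ.comap (MonoidHom.inr E G)).subgroupOf N with hK
  have hN : ∀ n : N, ∃ e : E, (e, (n : G)) ∈ Γ := by
    rintro ⟨_, ⟨⟨e, n⟩, h, rfl⟩⟩
    exact ⟨e, h⟩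
  choose e he using hN
  have hKfi : K.FiniteIndex := by
    rw [Subgroup.finiteIndex_iff_finite_quotient]
    refine Finite.of_injective (fun q : N ⧸ K => e q.out) fun p q hpq => ?_
    rw [← p.out_eq', ← q.out_eq']
    refine QuotientGroup.eq.2 ?_
    have h1 := mul_mem (inv_mem (he p.out)) (he q.out)
    simp only at hpq
    rw [hpq, Prod.inv_mk, Prod.mk_mul_mk, inv_mul_cancel] at h1
    exact h1
  obtain ⟨M, hM, hMfi, hMK⟩ := exists_characteristic_finiteIndex_le hfg K
  have hMn : (M.map N.subtype).Normal := ConjAct.normal_of_characteristic_of_normal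
  refine ⟨M.map N.subtype, hMn, hv.of_finiteIndex_normal ?_, ?_⟩
  · rwa [Subgroup.subgroupOf, Subgroup.comap_map_eq_self_of_injective N.subtype_injective]
  · rintro _ ⟨n, hn, rfl⟩
    exact hMK hn

lemma Descends.of_injective {E F : Type u} [Group E] [Group F] (h : Descends E) (f : F →* E)
    (hf : Function.Injective f) : Descends F := by
  intro G _ hG Γ hn hv
  have h1 : (Γ.map (f.prodMap (MonoidHom.id G))).map (MonoidHom.snd E G) =
      Γ.map (MonoidHom.snd F G) := by
    rw [Subgroup.map_map]; rfl
  obtain ⟨M, hM, hMv, hM'⟩ := h G hG (Γ.map (f.prodMap (MonoidHom.id G))) (by rwa [h1])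
    (by rwa [h1])
  refine ⟨M, hM, hMv, fun n hn => ?_⟩
  obtain ⟨⟨e, m⟩, h2, h3⟩ := hM' n hn
  obtain rfl : e = 1 := hf ((congrArg Prod.fst h3).trans (map_one f).symm)
  obtain rfl : m = n := congrArg Prod.snd h3
  exact h2

lemma Descends.of_surjective {E F : Type u} [Group E] [Group F] (h : Descends E) (f : E →* F)
    (hf : Function.Surjective f) : Descends F := by
  intro G _ hG Γ hn hv
  have h1 : (Γ.comap (f.prodMap (MonoidHom.id G))).map (MonoidHom.snd E G) =
      Γ.map (MonoidHom.snd F G) := by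
    ext n
    constructor
    · rintro ⟨⟨e, m⟩, h, rfl⟩
      exact ⟨(f e, m), h, rfl⟩
    · rintro ⟨⟨e, m⟩, h, rfl⟩
      obtain ⟨e, rfl⟩ := hf e
      exact ⟨(e, m), h, rfl⟩
  obtain ⟨M, hM, hMv, hM'⟩ := h G hG (Γ.comap (f.prodMap (MonoidHom.id G))) (by rwa [h1])
    (by rwa [h1])
  refine ⟨M, hM, hMv, fun n hn => ?_⟩
  have h2 : (f 1, n) ∈ Γ := hM' n hn
  rwa [map_one] at h2

lemma Descends.of_extension {E : Type u} [Group E] (K : Subgroup E) [K.Normal]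
    (h1 : Descends K) (h2 : Descends (E ⧸ K)) : Descends E := by
  intro G _ hG Γ hn hv
  set p := (QuotientGroup.mk' K).prodMap (MonoidHom.id G)
  have h3 : (Γ.map p).map (MonoidHom.snd (E ⧸ K) G) = Γ.map (MonoidHom.snd E G) := by
    rw [Subgroup.map_map]; rfl
  obtain ⟨M, hM, hMv, hM'⟩ := h2 G hG (Γ.map p) (by rwa [h3]) (by rwa [h3])
  set Γ' := Γ.comap (K.subtype.prodMap (MonoidHom.id G)) ⊓ M.comap (MonoidHom.snd K G)
  have h4 : Γ'.map (MonoidHom.snd K G) = M := by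
    refine le_antisymm ?_ fun n hn => ?_
    · rintro _ ⟨x, hx, rfl⟩
      exact hx.2
    · obtain ⟨⟨e, m⟩, h5, h6⟩ := hM' n hn
      obtain rfl : m = n := congrArg Prod.snd h6
      have h7 : e ∈ K := (QuotientGroup.eq_one_iff _).1 (congrArg Prod.fst h6)
      exact ⟨(⟨e, h7⟩, m), ⟨h5, hn⟩, rfl⟩
  obtain ⟨M', hM1, hM2, hM3⟩ := h1 G hG Γ' (by rwa [h4]) (by rwa [h4])
  exact ⟨M', hM1, hM2, fun n hn => (hM3 n hn).1⟩

lemma Descends.of_directed {E : Type u} [Group E] {ι : Type*} (K : ι → Subgroup E)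
    (hdir : Directed (· ≤ ·) K) (htop : ⨆ i, K i = ⊤) (h : ∀ i, Descends (K i)) :
    Descends E := by
  intro G _ hG Γ hn hv
  rcases isEmpty_or_nonempty ι with hι | hι
  · refine ⟨_, hn, hv, ?_⟩
    rw [iSup_of_empty] at htop
    rintro _ ⟨⟨e, n⟩, h1, rfl⟩
    obtain rfl : e = 1 := Subgroup.mem_bot.1 (htop ▸ Subgroup.mem_top e)
    exact h1
  obtain ⟨S, hS⟩ : (Γ.map (MonoidHom.snd E G)).FG := by
    obtain ⟨H, -, hH, c, hc⟩ := hv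
    exact hG.fg_of_lcs_le hc
  have hlift : ∀ s : S, ∃ i, ∃ e ∈ K i, (e, (s : G)) ∈ Γ := by
    rintro ⟨s, hs⟩
    have h1 : s ∈ Γ.map (MonoidHom.snd E G) := hS ▸ Subgroup.subset_closure hs
    obtain ⟨⟨e, s⟩, h2, rfl⟩ := h1
    have h3 : e ∈ ⨆ i, K i := htop ▸ Subgroup.mem_top e
    obtain ⟨i, hi⟩ := (Subgroup.mem_iSup_of_directed hdir).1 h3
    exact ⟨i, e, hi, h2⟩
  choose i e hei he using hlift
  obtain ⟨j, hj⟩ := hdir.finite_le i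
  set Γ' := Γ.comap ((K j).subtype.prodMap (MonoidHom.id G))
  have h4 : Γ'.map (MonoidHom.snd (K j) G) = Γ.map (MonoidHom.snd E G) := by
    refine le_antisymm ?_ ?_
    · rintro _ ⟨⟨k, n⟩, hx, rfl⟩
      exact ⟨(k, n), hx, rfl⟩
    · rw [← hS, Subgroup.closure_le]
      exact fun s hs => ⟨(⟨e ⟨s, hs⟩, hj _ (hei ⟨s, hs⟩)⟩, s), he ⟨s, hs⟩, rfl⟩
  obtain ⟨M, hM1, hM2, hM3⟩ := h j G hG Γ' (by rwa [h4]) (by rwa [h4])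
  exact ⟨M, hM1, hM2, hM3⟩

lemma _root_.ElementaryAmenable.descends {E : Type u} {inst : Group E}
    (h : ElementaryAmenable E inst) : Descends E := by
  induction h with
  | abelian E h => exact descends_of_comm E h
  | finite E h => exact descends_of_finite E
  | subgroup f hf _ ih => exact ih.of_injective f hf
  | quotient f hf _ ih => exact ih.of_surjective f hf
  | extension K _ _ ih1 ih2 => exact Descends.of_extension K ih1 ih2
  | directedUnion K hdir htop _ ih => exact Descends.of_directed K hdir htop ih

lemma ZeroEnt.vn {G : Type u} [Group G] (hG : ZeroEnt G) (hE : ElementaryAmenable G ‹_›) :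
    VN G := by
  have h1 : ((MonoidHom.id G).prod (MonoidHom.id G)).range.map (MonoidHom.snd G G) = ⊤ := by
    refine eq_top_iff.2 fun g _ => ⟨(g, g), ⟨g, rfl⟩, rfl⟩
  obtain ⟨M, -, hM, hM'⟩ := hE.descends G hG ((MonoidHom.id G).prod (MonoidHom.id G)).range
    (by rw [h1]; infer_instance) (by rw [h1]; exact ⟨⊤, inferInstance, inferInstance, 0, le_top⟩)
  refine hM.mono fun n hn => ?_
  obtain ⟨g, hg⟩ := hM' n hn
  exact (congrArg Prod.snd hg).symm.trans (congrArg Prod.fst hg)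

end UniformGrowth

namespace UniformGrowth

open scoped Pointwise commutatorElement
open Polynomial

variable {G : Type*} [Group G]

lemma eval_mono (p : ℕ[X]) {m n : ℕ} (h : m ≤ n) : p.eval m ≤ p.eval n := by
  rw [eval_eq_sum, eval_eq_sum]
  exact Finset.sum_le_sum fun i _ => Nat.mul_le_mul_left _ (Nat.pow_le_pow_left h i)

lemma tendsto_eval_div_pow {r : ℝ} (hr : 1 < r) (p : ℕ[X]) :
    Filter.Tendsto (fun n : ℕ => ((p.eval n : ℕ) : ℝ) / r ^ n) Filter.atTop (nhds 0) := by
  induction p using Polynomial.induction_on' with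
  | add p q hp hq => simpa [add_div] using hp.add hq
  | monomial d a =>
    simpa [mul_div_assoc] using (tendsto_pow_const_div_const_pow_of_one_lt d hr).const_mul (a : ℝ)

lemma finite_set_pow {F : Set G} (hF : F.Finite) (n : ℕ) : (F ^ n).Finite := by
  induction n with
  | zero => simp
  | succ n ih => rw [pow_succ]; exact ih.mul hF

/-- Finite subsets of `K` have polynomial growth. -/
def PolyGrowth (K : Subgroup G) : Prop :=
  ∀ F : Set G, F.Finite → F ⊆ K → ∃ p : ℕ[X], ∀ n, (F ^ n).ncard ≤ p.eval n

lemma exists_finite_forall_mem_pow {K : Subgroup G} (hK : K.FG) :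
    ∃ E : Set G, E.Finite ∧ 1 ∈ E ∧ E ⊆ K ∧ ∀ x ∈ K, ∃ m, x ∈ E ^ m := by
  obtain ⟨X, hX, hfin⟩ := (Subgroup.fg_iff K).1 hK
  have hXK : X ⊆ K := hX ▸ Subgroup.subset_closure
  refine ⟨insert 1 (X ∪ X⁻¹), (hfin.union hfin.inv).insert 1, Set.mem_insert _ _, ?_, ?_⟩
  · rintro x (rfl | hx | hx)
    · exact one_mem K
    · exact hXK hx
    · exact inv_mem_iff.1 (hXK hx)
  · have hinv : (insert 1 (X ∪ X⁻¹))⁻¹ = insert 1 (X ∪ X⁻¹) := by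
      rw [Set.inv_insert, inv_one, Set.union_inv, inv_inv, Set.union_comm]
    intro x hx
    rw [← hX] at hx
    induction hx using Subgroup.closure_induction with
    | mem x hx => exact ⟨1, by rw [pow_one]; exact Or.inr (Or.inl hx)⟩
    | one => exact ⟨0, rfl⟩
    | mul x y _ _ h1 h2 =>
      obtain ⟨m, h1⟩ := h1
      obtain ⟨n, h2⟩ := h2
      exact ⟨m + n, by rw [pow_add]; exact Set.mul_mem_mul h1 h2⟩
    | inv x _ h =>
      obtain ⟨m, h⟩ := h
      exact ⟨m, by rw [← hinv, inv_pow]; exact Set.inv_mem_inv.2 h⟩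

section Distortion

variable {K : Subgroup G} [K.Normal] {E : Set G}

lemma exists_conj_pow_mem (h1 : (1 : G) ∈ E) (hE : ∀ x ∈ K, ∃ m, x ∈ E ^ m) {c : ℕ}
    (hc : lcs (⊤ : Subgroup G) c = ⊥) (t : G) {h : G} (hh : h ∈ K) :
    ∃ p : ℕ[X], ∀ k : ℕ, t ^ k * h * (t ^ k)⁻¹ ∈ E ^ p.eval k := by
  suffices ∀ i ≤ c, ∀ h ∈ K, h ∈ lcs (⊤ : Subgroup G) i →
      ∃ p : ℕ[X], ∀ k : ℕ, t ^ k * h * (t ^ k)⁻¹ ∈ E ^ p.eval k from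
    this 0 (Nat.zero_le c) h hh trivial
  intro i hi
  induction hi using Nat.decreasingInduction with
  | self =>
    intro h _ hh
    rw [hc, Subgroup.mem_bot] at hh
    exact ⟨0, fun k => by simp [hh]⟩
  | of_succ i hi ih =>
    intro h hK hh
    have hu : ⁅t, h⁆ ∈ lcs (⊤ : Subgroup G) (i + 1) := by
      rw [← inv_mem_iff, commutatorElement_inv, lcs_succ]
      exact Subgroup.commutator_mem_commutator hh trivial
    obtain ⟨p, hp⟩ := ih ⁅t, h⁆
      (mul_mem (Subgroup.Normal.conj_mem inferInstance h hK t) (inv_mem hK)) hu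
    obtain ⟨m, hm⟩ := hE h hK
    have key : ∀ k : ℕ, t ^ k * h * (t ^ k)⁻¹ ∈ E ^ (m + k * p.eval k) := by
      intro k
      induction k with
      | zero => simpa using hm
      | succ k ihk =>
        have h2 : t ^ (k + 1) * h * (t ^ (k + 1))⁻¹ =
            (t ^ k * ⁅t, h⁆ * (t ^ k)⁻¹) * (t ^ k * h * (t ^ k)⁻¹) := by
          rw [commutatorElement_def, pow_succ]; group
        rw [h2]
        have h3 := Set.mul_mem_mul (hp k) ihk
        rw [← pow_add] at h3
        refine Set.pow_subset_pow_right h1 ?_ h3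
        have h4 := eval_mono p (Nat.le_succ k)
        have h5 := Nat.mul_le_mul_left k h4
        simp only [Nat.succ_eq_add_one] at h4 h5
        rw [add_mul, one_mul]
        omega
    exact ⟨C m + X * p, fun k => by simpa using key k⟩

lemma exists_conj_zpow_mem (h1 : (1 : G) ∈ E) (hE : ∀ x ∈ K, ∃ m, x ∈ E ^ m) {c : ℕ}
    (hc : lcs (⊤ : Subgroup G) c = ⊥) (t : G) {h : G} (hh : h ∈ K) :
    ∃ p : ℕ[X], ∀ k : ℤ, t ^ k * h * (t ^ k)⁻¹ ∈ E ^ p.eval k.natAbs := by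
  obtain ⟨p, hp⟩ := exists_conj_pow_mem h1 hE hc t hh
  obtain ⟨q, hq⟩ := exists_conj_pow_mem h1 hE hc t⁻¹ hh
  refine ⟨p + q, fun k => ?_⟩
  rw [eval_add]
  rcases Int.natAbs_eq k with hk | hk
  · refine Set.pow_subset_pow_right h1 (Nat.le_add_right _ _) ?_
    have h2 : t ^ k = t ^ k.natAbs := by rw [← zpow_natCast, ← hk]
    exact h2 ▸ hp k.natAbs
  · refine Set.pow_subset_pow_right h1 (Nat.le_add_left _ _) ?_
    have h2 : t ^ k = t⁻¹ ^ k.natAbs := by rw [inv_pow, ← zpow_natCast, ← zpow_neg, ← hk]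
    exact h2 ▸ hq k.natAbs

end Distortion

lemma PolyGrowth.sup_zpowers {K : Subgroup G} [K.Normal] (hK : PolyGrowth K) (hfg : K.FG) {c : ℕ}
    (hc : lcs (⊤ : Subgroup G) c = ⊥) (t : G) : PolyGrowth (K ⊔ Subgroup.zpowers t) := by
  obtain ⟨E, hEfin, h1, hEK, hE⟩ := exists_finite_forall_mem_pow hfg
  intro F hF hFK
  obtain ⟨g, hg⟩ := hK E hEfin hEK
  have hdec : ∀ f : G, ∃ y ∈ K, ∃ k : ℤ, f ∈ F → f = y * t ^ k := by
    intro f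
    by_cases hf : f ∈ F
    · obtain ⟨y, hy, k, h⟩ := mem_sup_zpowers_of_normal (hFK hf)
      exact ⟨y, hy, k, fun _ => h⟩
    · exact ⟨1, one_mem K, 0, fun h => absurd h hf⟩
  choose y hy k hyk using hdec
  choose p hp using fun f => exists_conj_zpow_mem h1 hE hc t (hy f)
  set a := ∑ f ∈ hF.toFinset, (k f).natAbs
  set q := ∑ f ∈ hF.toFinset, p f
  have ha : ∀ f ∈ F, (k f).natAbs ≤ a := fun f hf =>
    Finset.single_le_sum (f := fun f => (k f).natAbs) (fun _ _ => Nat.zero_le _)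
      (hF.mem_toFinset.2 hf)
  have hq : ∀ f ∈ F, ∀ n, (p f).eval n ≤ q.eval n := fun f hf n => by
    rw [eval_finsetSum]
    exact Finset.single_le_sum (f := fun f => (p f).eval n) (fun _ _ => Nat.zero_le _)
      (hF.mem_toFinset.2 hf)
  have key : ∀ n, F ^ n ⊆ E ^ (n * q.eval (a * n)) *
      (fun j : ℤ => t ^ j) '' Finset.Icc (-(a * n : ℕ) : ℤ) (a * n : ℕ) := by
    intro n
    induction n with
    | zero => simp
    | succ n ih =>
      rw [pow_succ]
      rintro _ ⟨w, hw, f, hf, rfl⟩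
      obtain ⟨e, he, _, ⟨j, hj, rfl⟩, rfl⟩ := ih hw
      rw [Finset.coe_Icc, Set.mem_Icc] at hj
      have h2 := ha f hf
      refine ⟨e * (t ^ j * y f * (t ^ j)⁻¹), ?_, t ^ (j + k f), ⟨j + k f, ?_, rfl⟩, ?_⟩
      · have h3 := Set.mul_mem_mul he (hp f j)
        rw [← pow_add] at h3
        refine Set.pow_subset_pow_right h1 ?_ h3
        have h4 := eval_mono q (Nat.mul_le_mul_left a (Nat.le_succ n))
        have h5 := (hq f hf j.natAbs).trans (eval_mono q (show j.natAbs ≤ a * n by omega))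
        have h6 := Nat.mul_le_mul_left n h4
        simp only [Nat.succ_eq_add_one] at h4 h6
        rw [add_mul, one_mul]
        omega
      · rw [Finset.coe_Icc, Set.mem_Icc, Nat.mul_succ]
        omega
      · have h3 := hyk f hf
        generalize y f = z at h3
        generalize k f = l at h3
        subst h3
        simp only [zpow_add]
        group
  refine ⟨g.comp (X * q.comp (C a * X)) * (C (2 * a) * X + 1), fun n => ?_⟩
  have h2 : (E ^ (n * q.eval (a * n)) *
      (fun j : ℤ => t ^ j) '' Finset.Icc (-(a * n : ℕ) : ℤ) (a * n : ℕ)).Finite :=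
    (finite_set_pow hEfin _).mul ((Finset.finite_toSet _).image _)
  refine (Set.ncard_le_ncard (key n) h2).trans ?_
  refine (Set.natCard_mul_le (s := E ^ (n * q.eval (a * n)))).trans ?_
  simp only [eval_mul, eval_comp, eval_add, eval_X, eval_C, eval_one]
  refine Nat.mul_le_mul (hg _) ((Set.ncard_image_le (Finset.finite_toSet _)).trans ?_)
  rw [Set.ncard_coe_finset, Int.card_Icc]
  rw [mul_assoc]
  omega

lemma polyGrowth_top_of_nilpotent (hfg : Group.FG G) {c : ℕ}
    (hc : lcs (⊤ : Subgroup G) c = ⊥) : PolyGrowth (⊤ : Subgroup G) := by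
  obtain ⟨X, hX⟩ := Group.fg_def.1 hfg
  have hS := symmGen_of_closure_eq_top hX
  set S := (insert 1 (X ∪ (X : Set G)⁻¹) : Set G)
  suffices ∀ i ≤ c, (lcs (⊤ : Subgroup G) i).FG ∧ PolyGrowth (lcs (⊤ : Subgroup G) i) from
    (this 0 (Nat.zero_le c)).2
  intro i hi
  induction hi using Nat.decreasingInduction with
  | self =>
    rw [hc]
    refine ⟨⟨∅, by simp⟩, fun F _ hF => ⟨1, fun n => ?_⟩⟩
    have h1 : F ^ n ⊆ ((⊥ : Subgroup G) : Set G) := by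
      refine (Set.pow_subset_pow_left hF).trans ?_
      intro x hx
      exact Submonoid.pow_subset (s := (⊥ : Subgroup G).toSubmonoid) subset_rfl hx
    rw [eval_one, ← Set.ncard_singleton (1 : G)]
    exact Set.ncard_le_ncard h1
  | of_succ i hi ih =>
    rw [← normalClosure_commIter hS] at ih
    have h2 : Subgroup.normalClosure (commIter S i ∪ commIter S (i + 1)) = lcs ⊤ i := by
      rw [Subgroup.normalClosure_union, normalClosure_commIter hS, normalClosure_commIter hS,
        sup_of_le_left (lcs_antitone _ (Nat.le_succ i))]
    rw [← h2]
    have hcomm : ∀ s ∈ S, ∀ t ∈ commIter S i, ⁅s, t⁆ ∈ commIter S (i + 1) :=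
      fun s hs t ht => ⟨s, hs, t, ht, rfl⟩
    have hT := commIter_finite hS i
    generalize commIter S i = T at hcomm hT
    generalize commIter S (i + 1) = Y at hcomm ih
    clear h2
    induction T, hT using Set.Finite.induction_on with
    | empty => simpa using ih
    | @insert t T _ hT ihT =>
      have ihT := ihT fun s hs t ht => hcomm s hs t (Or.inr ht)
      rw [Set.insert_union, normalClosure_insert_eq hS
        fun s hs => Or.inr (hcomm s hs t (Or.inl rfl))]
      exact ⟨ihT.1.sup ⟨{t}, by simp [Subgroup.zpowers_eq_closure]⟩,
        ihT.2.sup_zpowers ihT.1 hc t⟩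

lemma VN.polyGrowth (hfg : Group.FG G) (h : VN G) : PolyGrowth (⊤ : Subgroup G) := by
  obtain ⟨H, -, hH, c, hc⟩ := h
  have hHfg : Group.FG H := inferInstance
  have hHc : lcs (⊤ : Subgroup H) c = ⊥ := by
    rw [← (Subgroup.map_eq_bot_iff_of_injective _ H.subtype_injective), lcs_top_map_subtype]
    exact le_bot_iff.1 hc
  intro F hF _
  set R : Set G := Set.range fun q : G ⧸ H => (q.out)⁻¹
  have hRfin : R.Finite := Set.finite_range _
  have hR : ∀ g : G, ∃ r ∈ R, g * r⁻¹ ∈ H := fun g => by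
    refine ⟨_, ⟨(g⁻¹ : G), rfl⟩, ?_⟩
    have h1 : ((g⁻¹ : G) : G ⧸ H) = ((g⁻¹ : G) : G ⧸ H).out := (Quotient.out_eq' _).symm
    simpa using QuotientGroup.eq.1 h1
  set E : Set H := H.subtype ⁻¹' (R * F * R⁻¹)
  have hEfin : E.Finite := ((hRfin.mul hF).mul hRfin.inv).preimage H.subtype_injective.injOn
  obtain ⟨p, hp⟩ := polyGrowth_top_of_nilpotent hHfg hHc E hEfin fun _ _ => trivial
  have key : ∀ n, R * F ^ n ⊆ H.subtype '' (E ^ n) * R := by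
    intro n
    induction n with
    | zero => simp
    | succ n ih =>
      rw [pow_succ, ← mul_assoc]
      rintro _ ⟨w, hw, f, hf, rfl⟩
      obtain ⟨_, ⟨e, he, rfl⟩, r, hr, rfl⟩ := ih hw
      obtain ⟨r', hr', h2⟩ := hR (r * f)
      refine ⟨_, ⟨e * ⟨_, h2⟩, ?_, rfl⟩, r', hr', ?_⟩
      · rw [pow_succ]
        exact Set.mul_mem_mul he (Set.mul_mem_mul (Set.mul_mem_mul hr hf) (Set.inv_mem_inv.2 hr'))
      · simp [mul_assoc]
  obtain ⟨r, hr, -⟩ := hR 1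
  refine ⟨p * C R.ncard, fun n => ?_⟩
  have hfin : (H.subtype '' (E ^ n) * R).Finite := ((finite_set_pow hEfin n).image _).mul hRfin
  have h3 : (fun x => r * x) '' (F ^ n) ⊆ H.subtype '' (E ^ n) * R := by
    rintro _ ⟨x, hx, rfl⟩
    exact key n (Set.mul_mem_mul hr hx)
  rw [← Set.ncard_image_of_injective (F ^ n) (mul_right_injective r), eval_mul, eval_C]
  refine (Set.ncard_le_ncard h3 hfin).trans
    ((Set.natCard_mul_le (s := H.subtype '' (E ^ n))).trans ?_)
  exact Nat.mul_le_mul_right _ ((Set.ncard_image_le (finite_set_pow hEfin n)).trans (hp n))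

lemma VN.growthRateX_le_one (h : VN G) {X : Finset G}
    (hX : Subgroup.closure (X : Set G) = ⊤) : growthRateX X ≤ 1 := by
  by_contra! hr
  obtain ⟨p, hp⟩ := h.polyGrowth (Group.fg_def.2 ⟨X, hX⟩) _ (symmGen_of_closure_eq_top hX).finite
    fun _ _ => trivial
  have hb : BddBelow (Set.range fun n : ℕ => (growthFn X (n + 1) : ℝ) ^ ((1 : ℝ) / (n + 1))) := by
    refine ⟨0, ?_⟩
    rintro _ ⟨n, rfl⟩
    positivity
  have hle : ∀ n : ℕ, growthRateX X ^ (n + 1) ≤ p.eval (n + 1) := by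
    intro n
    have h1 := pow_le_pow_left₀ (zero_le_one.trans hr.le) (ciInf_le hb n) (n + 1)
    refine h1.trans ?_
    rw [← Real.rpow_natCast, ← Real.rpow_mul (Nat.cast_nonneg _)]
    push_cast
    rw [one_div_mul_cancel (by positivity), Real.rpow_one]
    have h2 := hp (n + 1)
    rw [← wordBall_eq_pow] at h2
    exact_mod_cast h2
  have ht := (tendsto_eval_div_pow hr p).comp (Filter.tendsto_add_atTop_nat 1)
  obtain ⟨n, hn⟩ := (ht.eventually (gt_mem_nhds one_pos)).exists
  simp only [Function.comp_apply] at hn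
  rw [div_lt_one (by positivity)] at hn
  exact absurd (hle n) (not_le.2 (by exact_mod_cast hn))

end UniformGrowth

/-- Every finitely generated elementary amenable group of exponential growth has
uniformly exponential growth, i.e. `ω(G) > 1`. -/
theorem fg_elementaryAmenable_exponential_growth_uniform
    {G : Type u} [inst : Group G] (hfg : Group.FG G)
    (hEA : ElementaryAmenable G inst) (hexp : HasExponentialGrowth G) :
    1 < minGrowthRate G := by
  by_contra! h
  obtain ⟨X, hX, hr⟩ := hexp
  exact hr.not_ge (((UniformGrowth.zeroEnt_of_minGrowthRate_le_one hfg h).vn hEA).growthRateX_le_one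
    hX)
end

section
/- Let G be a group with finite generating set X, and let V = {v_1, …, v_p} and W be finite subsets of G satisfying: (I) X ∪ X⁻¹ ⊆ V; (II) setting V_i = {v_1, …, v_i}, for all i, j ∈ {1, …, p} either [V_i, V_j] ⊆ V_{min{i,j}−1} or [V_i, V_j] ⊆ W; (III) for each i and each w ∈ W there is L_i ∈ ℕ with ⟨v_i^{−l} w v_i^{l} : l ∈ ℤ⟩ = ⟨v_i^{−l} w v_i^{l} : |l| ≤ L_i⟩. Put L = max_i L_i and let Z be the set of all elements v⁻¹wv with w ∈ W and v a product of elements of V^{±1} in which each letter v_i^{±1} occurs at most L times. Then the normal closure of W in G equals the subgroup generated by Z: ⟨W⟩^G = ⟨Z⟩. -/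
/-- The commutator `[x,y] = x⁻¹y⁻¹xy` (the convention used in the paper). -/
def pComm {G : Type*} [Group G] (x y : G) : G := x⁻¹ * y⁻¹ * x * y

/-- Evaluation of a word over the alphabet `V^{±1}`: a word is a list of pairs
`(i, sign)`, the letter being `v_i` if `sign = true` and `v_i⁻¹` otherwise. -/
def evalWord {G : Type*} [Group G] {p : ℕ} (V : Fin p → G) (l : List (Fin p × Bool)) : G :=
  (l.map fun q => if q.2 then V q.1 else (V q.1)⁻¹).prod

/-- `λ_i(l)`: the number of occurrences of the letters `v_i^{±1}` in the word `l`. -/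
def lambdaCount {p : ℕ} (i : Fin p) (l : List (Fin p × Bool)) : ℕ :=
  (l.map Prod.fst).count i

/-- The paper's set `V_m = {v_1, …, v_m}` (here `V : Fin p → G` lists `v_1, …, v_p`, with
`v_{k+1} = V k`). -/
def Vinit {G : Type*} [Group G] {p : ℕ} (V : Fin p → G) (m : ℕ) : Set G :=
  {g | ∃ k : Fin p, (k : ℕ) < m ∧ g = V k}

open scoped Pointwise

section Words

variable {G : Type*} [Group G] {p : ℕ} (V : Fin p → G)

theorem evalWord_cons (q : Fin p × Bool) (u : List (Fin p × Bool)) :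
    evalWord V (q :: u) = (if q.2 then V q.1 else (V q.1)⁻¹) * evalWord V u := by
  simp [evalWord]

theorem evalWord_append (u v : List (Fin p × Bool)) :
    evalWord V (u ++ v) = evalWord V u * evalWord V v := by
  simp [evalWord]

theorem lambdaCount_cons (i : Fin p) (q : Fin p × Bool) (u : List (Fin p × Bool)) :
    lambdaCount i (q :: u) = lambdaCount i u + if q.1 = i then 1 else 0 := by
  simp [lambdaCount, List.count_cons]

theorem lambdaCount_append (i : Fin p) (u v : List (Fin p × Bool)) :
    lambdaCount i (u ++ v) = lambdaCount i u + lambdaCount i v := by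
  simp [lambdaCount]

/-- Every power of a letter is the value of a word in that letter of the expected length. -/
theorem exists_evalWord_eq_zpow (i : Fin p) (l : ℤ) :
    ∃ u, evalWord V u = V i ^ l ∧ lambdaCount i u = l.natAbs ∧
      ∀ k, k ≠ i → lambdaCount k u = 0 := by
  obtain ⟨n, rfl | rfl⟩ := l.eq_nat_or_neg
  · refine ⟨List.replicate n (i, true), by simp [evalWord], by simp [lambdaCount], fun k hk => ?_⟩
    simp [lambdaCount, List.count_replicate, hk.symm]
  · refine ⟨List.replicate n (i, false), by simp [evalWord], by simp [lambdaCount], fun k hk => ?_⟩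
    simp [lambdaCount, List.count_replicate, hk.symm]

theorem evalWord_surjective {X : Set G} (hX : Subgroup.closure X = ⊤)
    (hV : X ⊆ Set.range V) : Function.Surjective (evalWord V) := by
  intro g
  have hg : g ∈ Subgroup.closure X := hX ▸ Subgroup.mem_top g
  induction hg using Subgroup.closure_induction_left with
  | one => exact ⟨[], rfl⟩
  | mul_left x hx y _ ih =>
    obtain ⟨u, rfl⟩ := ih
    obtain ⟨i, rfl⟩ := hV hx
    exact ⟨(i, true) :: u, by simp [evalWord_cons]⟩
  | inv_mul_cancel x hx y _ ih =>
    obtain ⟨u, rfl⟩ := ih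
    obtain ⟨i, rfl⟩ := hV hx
    exact ⟨(i, false) :: u, by simp [evalWord_cons]⟩

end Words

section Action

variable {G Ω : Type*} [Group G] [MulAction G Ω]

/-- If `h^{±1}` maps `S` into `T` and the commutator `[g, h]` stabilizes all translates of `S`
and `T` by powers of `g`, then `h^{±1}` maps `g ^ l • S` into `g ^ l • T` for every `l`. -/
theorem smul_zpow_smul_subset {g h : G} {S T : Set Ω}
    (hS : ∀ l : ℤ, pComm g h ∈ MulAction.stabilizer G (g ^ l • S))
    (hT : ∀ l : ℤ, pComm g h ∈ MulAction.stabilizer G (g ^ l • T))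
    (hh : h • S ⊆ T) (hh' : h⁻¹ • S ⊆ T) (l : ℤ) :
    h • g ^ l • S ⊆ g ^ l • T ∧ h⁻¹ • g ^ l • S ⊆ g ^ l • T := by
  induction l with
  | zero => simpa using ⟨hh, hh'⟩
  | succ n ih =>
    have hS' := MulAction.mem_stabilizer_iff.1 (inv_mem (hS n))
    have hT' := MulAction.mem_stabilizer_iff.1 (hT n)
    rw [add_comm, zpow_one_add, mul_smul, mul_smul]
    constructor
    · have e : h • g • g ^ (n : ℤ) • S = g • h • (pComm g h)⁻¹ • g ^ (n : ℤ) • S := by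
        simp only [smul_smul]; congr 1; simp only [pComm]; group
      rw [e, hS']
      exact Set.smul_set_mono ih.1
    · have e : h⁻¹ • g • g ^ (n : ℤ) • S = g • pComm g h • h⁻¹ • g ^ (n : ℤ) • S := by
        simp only [smul_smul]; congr 1; simp only [pComm]; group
      rw [e, ← hT']
      exact Set.smul_set_mono (Set.smul_set_mono ih.2)
  | pred n ih =>
    have hS' := MulAction.mem_stabilizer_iff.1 (hS (-n - 1))
    have hT' := MulAction.mem_stabilizer_iff.1 (inv_mem (hT (-n - 1)))
    have hz (R : Set Ω) : g ^ (-n - 1 : ℤ) • R = g⁻¹ • g ^ (-n : ℤ) • R := by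
      rw [sub_eq_neg_add, zpow_add, zpow_neg_one, mul_smul]
    rw [hz] at hS' hT' ⊢
    rw [hz]
    constructor
    · have e : h • g⁻¹ • g ^ (-n : ℤ) • S =
          g⁻¹ • h • g • pComm g h • g⁻¹ • g ^ (-n : ℤ) • S := by
        simp only [smul_smul]; congr 1; simp only [pComm]; group
      rw [e, hS', smul_inv_smul]
      exact Set.smul_set_mono ih.1
    · have e : h⁻¹ • g⁻¹ • g ^ (-n : ℤ) • S =
          (pComm g h)⁻¹ • g⁻¹ • h⁻¹ • g ^ (-n : ℤ) • S := by
        simp only [smul_smul]; congr 1; simp only [pComm]; group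
      rw [e, ← hT']
      exact Set.smul_set_mono (Set.smul_set_mono ih.2)

theorem mem_stabilizer_of_forall_smul_eq {w : G} {U : Set Ω} (hw : ∀ x ∈ U, w • x = x) :
    w ∈ MulAction.stabilizer G U := by
  rw [MulAction.mem_stabilizer_set]
  refine fun x => ⟨fun hx => ?_, fun hx => by rwa [hw x hx]⟩
  have : w • x = x := MulAction.injective w (hw _ hx)
  rwa [this] at hx

/-- The points `u • x₀` where the word `u` avoids the letter `v_i`, uses each later letter `v_k`
at most `a k` times, and uses the earlier letters freely. -/
def boundedOrbit {p : ℕ} (V : Fin p → G) (x₀ : Ω) (i : Fin p) (a : Fin p → ℕ) : Set Ω :=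
  {x | ∃ u, lambdaCount i u = 0 ∧ (∀ k, i < k → lambdaCount k u ≤ a k) ∧ evalWord V u • x₀ = x}

theorem letter_smul_boundedOrbit_subset {p : ℕ} (V : Fin p → G) (x₀ : Ω) {i j : Fin p}
    {a b : Fin p → ℕ} (hij : j ≠ i) (hab : ∀ k, i < k → a k + (if j = k then 1 else 0) ≤ b k) :
    V j • boundedOrbit V x₀ i a ⊆ boundedOrbit V x₀ i b ∧
      (V j)⁻¹ • boundedOrbit V x₀ i a ⊆ boundedOrbit V x₀ i b := by
  have key (s : Bool) : (if s then V j else (V j)⁻¹) • boundedOrbit V x₀ i a ⊆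
      boundedOrbit V x₀ i b := by
    rintro _ ⟨_, ⟨u, hi, hk, rfl⟩, rfl⟩
    refine ⟨(j, s) :: u, by simp [lambdaCount_cons, hi, hij], fun k h => ?_, ?_⟩
    · rw [lambdaCount_cons]
      exact (Nat.add_le_add_right (hk k h) _).trans (hab k h)
    · simp [evalWord_cons, mul_smul]
  exact ⟨by simpa using key true, by simpa using key false⟩

section Step

variable {p : ℕ} {V : Fin p → G} {W : Set G} {x₀ : Ω} {i : Fin p} {N m : ℕ}
  (hII : ∀ a b : Fin p,
    (∀ u ∈ Vinit V ((a : ℕ) + 1), ∀ w ∈ Vinit V ((b : ℕ) + 1),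
      pComm u w ∈ Vinit V (min (a : ℕ) (b : ℕ))) ∨
    (∀ u ∈ Vinit V ((a : ℕ) + 1), ∀ w ∈ Vinit V ((b : ℕ) + 1), pComm u w ∈ W))
  (hm : m ≤ N)
  (hIII : ∀ w ∈ W,
    Subgroup.closure {x : G | ∃ l : ℤ, x = (V i ^ l)⁻¹ * w * V i ^ l} =
    Subgroup.closure {x : G | ∃ l : ℤ, |l| ≤ (m : ℤ) ∧ x = (V i ^ l)⁻¹ * w * V i ^ l})
  (hfix : ∀ u, (∀ k, i ≤ k → lambdaCount k u ≤ N) →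
    ∀ w ∈ W, w • evalWord V u • x₀ = evalWord V u • x₀)

include hm hIII hfix in
theorem smul_eq_of_mem_zpow_smul_boundedOrbit {a : Fin p → ℕ} (ha : ∀ k, i < k → a k ≤ N)
    (l : ℤ) {w : G} (hw : w ∈ W) {x : Ω} (hx : x ∈ V i ^ l • boundedOrbit V x₀ i a) :
    w • x = x := by
  obtain ⟨_, ⟨u, hi, hk, rfl⟩, rfl⟩ := hx
  have hconj (n : ℤ) : (V i ^ n)⁻¹ * w * V i ^ n ∈ MulAction.stabilizer G (evalWord V u • x₀) ↔
      w • V i ^ n • evalWord V u • x₀ = V i ^ n • evalWord V u • x₀ := by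
    rw [MulAction.mem_stabilizer_iff, mul_smul, mul_smul, inv_smul_eq_iff]
  have hle : Subgroup.closure {x : G | ∃ l : ℤ, |l| ≤ (m : ℤ) ∧ x = (V i ^ l)⁻¹ * w * V i ^ l} ≤
      MulAction.stabilizer G (evalWord V u • x₀) := by
    rw [Subgroup.closure_le]
    rintro _ ⟨n, hn, rfl⟩
    rw [SetLike.mem_coe, hconj]
    obtain ⟨v, hv, hvi, hvk⟩ := exists_evalWord_eq_zpow V i n
    rw [← hv, ← mul_smul (evalWord V v), ← evalWord_append]
    refine hfix _ (fun k hik => ?_) w hw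
    rw [lambdaCount_append]
    rcases hik.eq_or_lt with rfl | hik
    · rw [Int.abs_eq_natAbs] at hn
      omega
    · rw [hvk k hik.ne', zero_add]
      exact (hk k hik).trans (ha k hik)
  rw [← hIII w hw] at hle
  exact (hconj l).1 (hle (Subgroup.subset_closure ⟨l, rfl⟩))

include hII in
theorem pComm_mem_or (j : Fin p) :
    (∃ k : Fin p, k < i ∧ k < j ∧ pComm (V i) (V j) = V k) ∨ pComm (V i) (V j) ∈ W := by
  have h (k : Fin p) : V k ∈ Vinit V ((k : ℕ) + 1) := ⟨k, k.1.lt_succ_self, rfl⟩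
  refine (hII i j).imp (fun H => ?_) (fun H => H _ (h i) _ (h j))
  obtain ⟨k, hk, e⟩ := H _ (h i) _ (h j)
  exact ⟨k, (lt_min_iff.1 hk).1, (lt_min_iff.1 hk).2, e⟩

include hII hm hIII hfix in
theorem letter_mem_stabilizer_zpow_smul_boundedOrbit {a : Fin p → ℕ}
    (ha : ∀ k, i < k → a k ≤ N) (j : Fin p) (hj : j < i) (l : ℤ) :
    V j ∈ MulAction.stabilizer G (V i ^ l • boundedOrbit V x₀ i a) := by
  induction j using WellFoundedLT.induction generalizing l with
  | ind j ih =>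
    have hc (l : ℤ) : pComm (V i) (V j) ∈
        MulAction.stabilizer G (V i ^ l • boundedOrbit V x₀ i a) := by
      rcases pComm_mem_or hII (i := i) j with ⟨k, hki, hkj, e⟩ | hw
      · exact e ▸ ih k hkj hki l
      · exact mem_stabilizer_of_forall_smul_eq fun x hx =>
          smul_eq_of_mem_zpow_smul_boundedOrbit hm hIII hfix ha l hw hx
    have hS := letter_smul_boundedOrbit_subset V x₀ (a := a) (b := a) hj.ne
      fun k hk => by simp [(hj.trans hk).ne]
    have h := smul_zpow_smul_subset hc hc hS.1 hS.2 l
    rw [MulAction.mem_stabilizer_iff]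
    refine h.1.antisymm ?_
    rw [Set.subset_smul_set_iff]
    exact h.2

include hII hm hIII hfix in
theorem exists_mem_zpow_smul_boundedOrbit (u : List (Fin p × Bool))
    (hu : ∀ k, i < k → lambdaCount k u ≤ N) :
    ∃ l : ℤ, evalWord V u • x₀ ∈ V i ^ l • boundedOrbit V x₀ i (lambdaCount · u) := by
  induction u with
  | nil => exact ⟨0, by simpa using ⟨[], by simp [lambdaCount], by simp, rfl⟩⟩
  | cons q u ih =>
    obtain ⟨j, s⟩ := q
    have hu' (k : Fin p) (hk : i < k) : lambdaCount k u ≤ N :=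
      le_of_add_le_left ((lambdaCount_cons k (j, s) u).symm.trans_le (hu k hk))
    obtain ⟨l, hl⟩ := ih hu'
    rw [evalWord_cons, mul_smul]
    by_cases hji : j = i
    · subst hji
      have e : boundedOrbit V x₀ j (lambdaCount · ((j, s) :: u)) =
          boundedOrbit V x₀ j (lambdaCount · u) := by
        ext x
        refine exists_congr fun v => and_congr_right fun _ => and_congr_left fun _ =>
          forall₂_congr fun k hk => ?_
        simp [lambdaCount_cons, hk.ne]
      rw [e]
      cases s
      · refine ⟨-1 + l, ?_⟩
        rw [zpow_add, mul_smul, zpow_neg_one]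
        exact Set.smul_mem_smul_set hl
      · refine ⟨1 + l, ?_⟩
        rw [zpow_add, mul_smul, zpow_one]
        exact Set.smul_mem_smul_set hl
    · refine ⟨l, ?_⟩
      have hc {a : Fin p → ℕ} (ha : ∀ k, i < k → a k ≤ N) (l : ℤ) : pComm (V i) (V j) ∈
          MulAction.stabilizer G (V i ^ l • boundedOrbit V x₀ i a) := by
        rcases pComm_mem_or hII (i := i) j with ⟨k, hki, -, e⟩ | hw
        · exact e ▸ letter_mem_stabilizer_zpow_smul_boundedOrbit hII hm hIII hfix ha k hki l
        · exact mem_stabilizer_of_forall_smul_eq fun x hx =>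
            smul_eq_of_mem_zpow_smul_boundedOrbit hm hIII hfix ha l hw hx
      have hS := letter_smul_boundedOrbit_subset V x₀ (a := (lambdaCount · u))
        (b := (lambdaCount · ((j, s) :: u))) hji fun k _ => (lambdaCount_cons k (j, s) u).ge
      have h := smul_zpow_smul_subset (hc hu') (hc hu) hS.1 hS.2 l
      cases s
      · exact h.2 (Set.smul_mem_smul_set hl)
      · exact h.1 (Set.smul_mem_smul_set hl)

end Step

/-- If `W` fixes every point reached from `x₀` by a word with at most `N` occurrences of each
letter, then it fixes every point reached from `x₀` by any word. -/
theorem smul_evalWord_smul_eq {p : ℕ} {V : Fin p → G} {W : Set G} {x₀ : Ω} {N : ℕ}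
    (hII : ∀ a b : Fin p,
      (∀ u ∈ Vinit V ((a : ℕ) + 1), ∀ w ∈ Vinit V ((b : ℕ) + 1),
        pComm u w ∈ Vinit V (min (a : ℕ) (b : ℕ))) ∨
      (∀ u ∈ Vinit V ((a : ℕ) + 1), ∀ w ∈ Vinit V ((b : ℕ) + 1), pComm u w ∈ W))
    {L : Fin p → ℕ} (hL : ∀ i, L i ≤ N)
    (hIII : ∀ i : Fin p, ∀ w ∈ W,
      Subgroup.closure {x : G | ∃ l : ℤ, x = (V i ^ l)⁻¹ * w * V i ^ l} =
      Subgroup.closure {x : G | ∃ l : ℤ, |l| ≤ (L i : ℤ) ∧ x = (V i ^ l)⁻¹ * w * V i ^ l})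
    (hfix : ∀ u, (∀ k, lambdaCount k u ≤ N) →
      ∀ w ∈ W, w • evalWord V u • x₀ = evalWord V u • x₀)
    (u : List (Fin p × Bool)) {w : G} (hw : w ∈ W) :
    w • evalWord V u • x₀ = evalWord V u • x₀ := by
  have key (n : ℕ) (hn : n ≤ p) : ∀ u, (∀ k : Fin p, n ≤ k → lambdaCount k u ≤ N) →
      ∀ w ∈ W, w • evalWord V u • x₀ = evalWord V u • x₀ := by
    induction n with
    | zero => exact fun u hu => hfix u fun k => hu k k.1.zero_le
    | succ n ih =>
      intro u hu w hw
      have hfix' : ∀ u, (∀ k, (⟨n, hn⟩ : Fin p) ≤ k → lambdaCount k u ≤ N) →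
          ∀ w ∈ W, w • evalWord V u • x₀ = evalWord V u • x₀ := ih (Nat.le_of_succ_le hn)
      have hu' : ∀ k, (⟨n, hn⟩ : Fin p) < k → lambdaCount k u ≤ N := hu
      obtain ⟨l, hl⟩ := exists_mem_zpow_smul_boundedOrbit hII (hL _) (hIII _) hfix' u hu'
      exact smul_eq_of_mem_zpow_smul_boundedOrbit (hL _) (hIII _) hfix' hu' l hw hl
  exact key p le_rfl u (fun k hk => absurd k.2 hk.not_gt) w hw

end Action

/-- **Lemma 5.1 (Osin).** Let `G` be a group with finite generating set `X` and let
`V = {v_1, …, v_p}` (an ordered tuple) and `W` be finite subsets of `G` such that: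
(I) `X ∪ X⁻¹ ⊆ V`;
(II) for all `i, j` either `[V_i, V_j] ⊆ V_{min{i,j}-1}` or `[V_i, V_j] ⊆ W`;
(III) for every `i` there is `L_i` such that for every `w ∈ W`,
`⟨v_i⁻ˡ w v_iˡ : l ∈ ℤ⟩ = ⟨v_i⁻ˡ w v_iˡ : |l| ≤ L_i⟩`.
With `L = max_i L_i`, let `Z` be the set of all elements `v⁻¹ w v` with `w ∈ W` and `v` a
word over `V^{±1}` in which each letter `v_i^{±1}` occurs at most `L` times. Then the
normal closure of `W` in `G` is generated by `Z`: `⟨W⟩^G = ⟨Z⟩`. -/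
theorem normalClosure_eq_closure_bounded_conjugates
    {G : Type*} [Group G] (X : Finset G) (hX : Subgroup.closure (X : Set G) = ⊤)
    (p : ℕ) (V : Fin p → G) (W : Finset G)
    (hI : ∀ x ∈ X, (∃ i : Fin p, V i = x) ∧ (∃ i : Fin p, V i = x⁻¹))
    (hII : ∀ a b : Fin p,
      (∀ u ∈ Vinit V ((a : ℕ) + 1), ∀ w ∈ Vinit V ((b : ℕ) + 1),
        pComm u w ∈ Vinit V (min (a : ℕ) (b : ℕ))) ∨
      (∀ u ∈ Vinit V ((a : ℕ) + 1), ∀ w ∈ Vinit V ((b : ℕ) + 1),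
        pComm u w ∈ W))
    (L : Fin p → ℕ)
    (hIII : ∀ i : Fin p, ∀ w ∈ W,
      Subgroup.closure {x : G | ∃ l : ℤ, x = (V i ^ l)⁻¹ * w * V i ^ l} =
      Subgroup.closure {x : G | ∃ l : ℤ, |l| ≤ (L i : ℤ) ∧
        x = (V i ^ l)⁻¹ * w * V i ^ l}) :
    Subgroup.normalClosure (W : Set G) =
      Subgroup.closure {z : G | ∃ w ∈ W, ∃ l : List (Fin p × Bool),
        (∀ i : Fin p, lambdaCount i l ≤ Finset.univ.sup L) ∧
        z = (evalWord V l)⁻¹ * w * evalWord V l} := by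
  set Z : Set G := {z : G | ∃ w ∈ W, ∃ l : List (Fin p × Bool),
    (∀ i : Fin p, lambdaCount i l ≤ Finset.univ.sup L) ∧
    z = (evalWord V l)⁻¹ * w * evalWord V l}
  have hconj (u : List (Fin p × Bool)) (w : G) :
      w • evalWord V u • ((1 : G) : G ⧸ Subgroup.closure Z) =
        evalWord V u • ((1 : G) : G ⧸ Subgroup.closure Z) ↔
      (evalWord V u)⁻¹ * w * evalWord V u ∈ Subgroup.closure Z := by
    rw [← MulAction.stabilizer_quotient (Subgroup.closure Z), MulAction.mem_stabilizer_iff,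
      mul_smul, mul_smul, inv_smul_eq_iff, MulAction.stabilizer_quotient]
  apply le_antisymm
  · rw [Subgroup.normalClosure, Subgroup.closure_le]
    intro y hy
    obtain ⟨w, hw, hwy⟩ := Group.mem_conjugatesOfSet_iff.1 hy
    obtain ⟨g, rfl⟩ := isConj_iff.1 hwy
    obtain ⟨u, hu⟩ := evalWord_surjective V hX (fun x hx => (hI x hx).1) g⁻¹
    have h := (hconj u w).1 (smul_evalWord_smul_eq hII (fun i => Finset.le_sup (Finset.mem_univ i))
      hIII (fun v hv w hw => (hconj v w).2 (Subgroup.subset_closure ⟨w, hw, v, hv, rfl⟩)) u hw)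
    simpa [hu] using h
  · rw [Subgroup.closure_le]
    rintro _ ⟨w, hw, l, -, rfl⟩
    simpa using Subgroup.normalClosure_normal.conj_mem w (Subgroup.subset_normalClosure hw)
      (evalWord V l)⁻¹
end
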